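/- arXiv:2105.06088 — 2 statements merged into one kernel-verified Lean document; each statement's English description precedes it below -/
import Mathlib

section
/- Let γ̃ be the solution of the unconstrained entropy transport problem inf over γ ∈ M(ℝ^d × ℝ^d) of E_{Λ,KL}(γ|μ,ν). Then γ̃ = Z·γ, where Z = e^{−E_min/(2Λ)}, E_min = inf over γ ∈ P(ℝ^d × ℝ^d) of E_{Λ,KL}(γ|μ,ν), and γ is the (probability-measure) solution of the constrained entropy transport problem inf over γ ∈ P(ℝ^d × ℝ^d) of E_{Λ,KL}(γ|μ,ν). In particular the constrained problem attains its infimum. -/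
open MeasureTheory ENNReal Filter
open scoped Classical NNReal

/-- The divergence functional `D(σ‖λ) = ∫ F(dσ/dλ) dλ` if `σ ≪ λ`, and `+∞` otherwise. -/
noncomputable def divergenceF {α : Type*} [MeasurableSpace α]
    (F : ℝ≥0∞ → ℝ≥0∞) (σ lam : Measure α) : ℝ≥0∞ :=
  if σ ≪ lam then ∫⁻ x, F (σ.rnDeriv lam x) ∂lam else ⊤

/-- The entropy function `F(s) = s log s - s + 1` (equal to `+∞` at `s = +∞`),
generating the Kullback-Leibler divergence. -/
noncomputable def Fkl : ℝ≥0∞ → ℝ≥0∞ := fun r =>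
  if r = ⊤ then ⊤ else ENNReal.ofReal (r.toReal * Real.log r.toReal - r.toReal + 1)

/-- The KL entropy transport functional
`E_{Λ,KL}(γ|μ,ν) = ∬ c dγ + Λ D_KL(π₁#γ‖μ) + Λ D_KL(π₂#γ‖ν)`. -/
noncomputable def ETKL {d : ℕ}
    (c : EuclideanSpace ℝ (Fin d) × EuclideanSpace ℝ (Fin d) → ℝ≥0∞) (Λ : ℝ)
    (μ ν : Measure (EuclideanSpace ℝ (Fin d)))
    (γ : Measure (EuclideanSpace ℝ (Fin d) × EuclideanSpace ℝ (Fin d))) : ℝ≥0∞ :=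
  ∫⁻ p, c p ∂γ + ENNReal.ofReal Λ * divergenceF Fkl (γ.map Prod.fst) μ
    + ENNReal.ofReal Λ * divergenceF Fkl (γ.map Prod.snd) ν

lemma divergenceF_Fkl_eq {α : Type*} [MeasurableSpace α] (σ lam : Measure α)
    [IsFiniteMeasure σ] [IsFiniteMeasure lam] :
    divergenceF Fkl σ lam = InformationTheory.klDiv σ lam := by
  rw [InformationTheory.klDiv_eq_lintegral_klFun, divergenceF]
  split_ifs with hac
  · refine lintegral_congr_ae ?_
    filter_upwards [σ.rnDeriv_ne_top lam] with x hx
    simp only [Fkl, hx, if_false, InformationTheory.klFun_apply]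
    congr 1
    ring
  · rfl

lemma klDiv_smul_ne_top {α : Type*} [MeasurableSpace α] (σ lam : Measure α)
    [IsFiniteMeasure σ] [IsFiniteMeasure lam] (s : ℝ≥0)
    (hfin : InformationTheory.klDiv σ lam ≠ ⊤) :
    InformationTheory.klDiv (s • σ) lam ≠ ⊤ := by
  obtain ⟨h1, h2⟩ := InformationTheory.klDiv_ne_top_iff.1 hfin
  by_cases hs : s = 0
  · subst hs
    simp
  refine InformationTheory.klDiv_ne_top (h1.smul_left s) ?_
  have hae : llr (s • σ) lam =ᵐ[s • σ] fun x => llr σ lam x + Real.log s := by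
    have h4 := llr_smul_left h1 (s : ℝ≥0∞) (by simpa using hs) (by simp)
    have h5 : llr (s • σ) lam =ᵐ[σ] fun x => llr σ lam x + Real.log s := by simpa using h4
    have h3 : (s • σ) ≪ σ := Measure.AbsolutelyContinuous.rfl.smul_left s
    exact h3.ae_le h5
  rw [integrable_congr hae]
  exact Integrable.add (h2.smul_measure_nnreal) (integrable_const _)

lemma klDiv_le_one_of_le {α : Type*} [MeasurableSpace α] (σ lam : Measure α)
    [IsProbabilityMeasure lam] (hle : σ ≤ lam) :
    InformationTheory.klDiv σ lam ≤ 1 := by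
  have : IsFiniteMeasure σ := isFiniteMeasure_of_le lam hle
  rw [InformationTheory.klDiv_eq_lintegral_klFun_of_ac (Measure.absolutelyContinuous_of_le hle)]
  calc ∫⁻ x, ENNReal.ofReal (InformationTheory.klFun (σ.rnDeriv lam x).toReal) ∂lam
      ≤ ∫⁻ x, 1 ∂lam := by
        refine lintegral_mono_ae ?_
        filter_upwards [Measure.rnDeriv_le_one_of_le hle] with x hx
        have hx1 : (σ.rnDeriv lam x).toReal ≤ 1 := by
          simpa using ENNReal.toReal_mono (by simp) hx
        have hx0 : 0 ≤ (σ.rnDeriv lam x).toReal := ENNReal.toReal_nonneg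
        rw [← ENNReal.ofReal_one]
        refine ENNReal.ofReal_le_ofReal ?_
        rw [InformationTheory.klFun_apply]
        have := mul_nonpos_of_nonneg_of_nonpos hx0 (Real.log_nonpos hx0 hx1)
        linarith
    _ = 1 := by simp

lemma ETKL_smul {d : ℕ}
    (c : EuclideanSpace ℝ (Fin d) × EuclideanSpace ℝ (Fin d) → ℝ≥0∞) (Λ : ℝ) (hΛ : 0 < Λ)
    (μ ν : Measure (EuclideanSpace ℝ (Fin d)))
    [IsProbabilityMeasure μ] [IsProbabilityMeasure ν]
    (γ : Measure (EuclideanSpace ℝ (Fin d) × EuclideanSpace ℝ (Fin d))) [IsFiniteMeasure γ]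
    (hγ : ETKL c Λ μ ν γ ≠ ⊤) (s : ℝ≥0) :
    ETKL c Λ μ ν (s • γ) ≠ ⊤ ∧
    (ETKL c Λ μ ν (s • γ)).toReal = s * (ETKL c Λ μ ν γ).toReal + 2 * Λ * (1 - s)
      + 2 * Λ * (s * Real.log s) * γ.real Set.univ := by
  have hΛ0 : ENNReal.ofReal Λ ≠ 0 := by simpa using hΛ
  unfold ETKL at *
  rw [Measure.map_smul, Measure.map_smul]
  simp only [divergenceF_Fkl_eq] at *
  rw [lintegral_smul_measure]
  obtain ⟨h12, h3⟩ := ENNReal.add_ne_top.1 hγ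
  obtain ⟨h1, h2⟩ := ENNReal.add_ne_top.1 h12
  have k1 : InformationTheory.klDiv (γ.map Prod.fst) μ ≠ ⊤ := by
    intro hh
    exact h2 (by rw [hh, ENNReal.mul_top hΛ0])
  have k2 : InformationTheory.klDiv (γ.map Prod.snd) ν ≠ ⊤ := by
    intro hh
    exact h3 (by rw [hh, ENNReal.mul_top hΛ0])
  have l1 := klDiv_smul_ne_top _ _ s k1
  have l2 := klDiv_smul_ne_top _ _ s k2
  have m1 : s • ∫⁻ p, c p ∂γ ≠ ⊤ := by
    rw [ENNReal.smul_def]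
    exact ENNReal.mul_ne_top (by simp) h1
  have m2 := ENNReal.mul_ne_top (ENNReal.ofReal_ne_top (r := Λ)) l1
  have m3 := ENNReal.mul_ne_top (ENNReal.ofReal_ne_top (r := Λ)) l2
  have m12 := ENNReal.add_ne_top.2 ⟨m1, m2⟩
  refine ⟨ENNReal.add_ne_top.2 ⟨m12, m3⟩, ?_⟩
  obtain ⟨a1, a2⟩ := InformationTheory.klDiv_ne_top_iff.1 k1
  obtain ⟨b1, b2⟩ := InformationTheory.klDiv_ne_top_iff.1 k2
  have e1 : (γ.map Prod.fst).real Set.univ = γ.real Set.univ := by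
    simp [measureReal_def, Measure.map_apply measurable_fst MeasurableSet.univ]
  have e2 : (γ.map Prod.snd).real Set.univ = γ.real Set.univ := by
    simp [measureReal_def, Measure.map_apply measurable_snd MeasurableSet.univ]
  rw [ENNReal.toReal_add m12 m3, ENNReal.toReal_add m1 m2, ENNReal.toReal_add h12 h3,
    ENNReal.toReal_add h1 h2, ENNReal.toReal_mul, ENNReal.toReal_mul, ENNReal.toReal_mul,
    ENNReal.toReal_mul, InformationTheory.toReal_klDiv_smul_left a1 a2,
    InformationTheory.toReal_klDiv_smul_left b1 b2, ENNReal.toReal_ofReal hΛ.le,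
    ENNReal.smul_def, smul_eq_mul, ENNReal.toReal_mul, e1, e2]
  simp only [ENNReal.coe_toReal, probReal_univ]
  ring

/-- There is a nonzero finite measure with finite energy. -/
lemma exists_prob_finite {d : ℕ}
    (h : EuclideanSpace ℝ (Fin d) → ℝ)
    (hcont : Continuous h)
    (c : EuclideanSpace ℝ (Fin d) × EuclideanSpace ℝ (Fin d) → ℝ≥0∞)
    (hch : c = fun p => ENNReal.ofReal (h (p.1 - p.2)))
    (Λ : ℝ) (hΛ : 0 < Λ)
    (μ ν : Measure (EuclideanSpace ℝ (Fin d)))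
    [IsProbabilityMeasure μ] [IsProbabilityMeasure ν] :
    ∃ γ : Measure (EuclideanSpace ℝ (Fin d) × EuclideanSpace ℝ (Fin d)),
      IsProbabilityMeasure γ ∧ ETKL c Λ μ ν γ ≠ ⊤ := by
  let A : ℕ → Set (EuclideanSpace ℝ (Fin d) × EuclideanSpace ℝ (Fin d)) :=
    fun n => {p | h (p.1 - p.2) ≤ n}
  have hA : ∀ n, MeasurableSet (A n) := fun n =>
    (isClosed_le (by fun_prop) continuous_const).measurableSet
  have hU : (⋃ n, A n) = Set.univ := by
    refine Set.eq_univ_of_forall fun p => Set.mem_iUnion.2 ?_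
    exact exists_nat_ge (h (p.1 - p.2))
  obtain ⟨n, hn⟩ : ∃ n, (μ.prod ν) (A n) ≠ 0 := by
    by_contra! hcon
    have := measure_iUnion_null hcon
    rw [hU] at this
    simp at this
  let γ := (μ.prod ν).restrict (A n)
  have hle : γ ≤ μ.prod ν := Measure.restrict_le_self
  have hγ : ETKL c Λ μ ν γ ≠ ⊤ := by
    unfold ETKL
    rw [divergenceF_Fkl_eq, divergenceF_Fkl_eq]
    have i1 : γ.map Prod.fst ≤ μ := by
      calc γ.map Prod.fst ≤ (μ.prod ν).map Prod.fst := Measure.map_mono hle measurable_fst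
        _ = μ := by simp [Measure.map_fst_prod]
    have i2 : γ.map Prod.snd ≤ ν := by
      calc γ.map Prod.snd ≤ (μ.prod ν).map Prod.snd := Measure.map_mono hle measurable_snd
        _ = ν := by simp [Measure.map_snd_prod]
    refine ENNReal.add_ne_top.2 ⟨ENNReal.add_ne_top.2 ⟨?_, ?_⟩, ?_⟩
    · have : ∫⁻ p, c p ∂γ ≤ ∫⁻ p, (n : ℝ≥0∞) ∂γ := by
        refine lintegral_mono_ae ?_
        filter_upwards [ae_restrict_mem (hA n)] with p hp
        rw [hch]
        exact (ENNReal.ofReal_le_ofReal hp).trans (by simp)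
      refine ne_top_of_le_ne_top ?_ this
      rw [lintegral_const]
      exact ENNReal.mul_ne_top (by simp) (measure_ne_top _ _)
    · exact ENNReal.mul_ne_top (by simp) (ne_top_of_le_ne_top (by simp) (klDiv_le_one_of_le _ _ i1))
    · exact ENNReal.mul_ne_top (by simp) (ne_top_of_le_ne_top (by simp) (klDiv_le_one_of_le _ _ i2))
  have hm : γ Set.univ ≠ 0 := by simpa [γ] using hn
  have hm' : γ Set.univ ≠ ⊤ := measure_ne_top _ _
  refine ⟨(γ Set.univ).toNNReal⁻¹ • γ, ⟨?_⟩, (ETKL_smul c Λ hΛ μ ν γ hγ _).1⟩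
  rw [Measure.smul_apply, ENNReal.smul_def, ENNReal.coe_inv, ENNReal.coe_toNNReal hm',
    smul_eq_mul, ENNReal.inv_mul_cancel hm hm']
  simpa [ENNReal.toNNReal_eq_zero_iff] using hm


/-- if `γt` solves the unconstrained entropy transport problem over all
finite positive measures, then `γt = Z • γ` where `Z = e^{−E_min/(2Λ)}`,
`E_min = inf {E_{Λ,KL}(γ|μ,ν) : γ ∈ P(ℝ^d × ℝ^d)}`, and `γ` is a probability measure
solving the constrained problem; in particular the constrained problem attains its
infimum. -/
theorem unconstrained_eq_scaled_constrained {d : ℕ}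
    (h : EuclideanSpace ℝ (Fin d) → ℝ) (hh0 : ∀ x, 0 ≤ h x)
    (hhconv : StrictConvexOn ℝ Set.univ h)
    (c : EuclideanSpace ℝ (Fin d) × EuclideanSpace ℝ (Fin d) → ℝ≥0∞)
    (hch : c = fun p => ENNReal.ofReal (h (p.1 - p.2)))
    (Λ : ℝ) (hΛ : 0 < Λ)
    (μ ν : Measure (EuclideanSpace ℝ (Fin d)))
    [IsProbabilityMeasure μ] [IsProbabilityMeasure ν]
    (hμ : μ ≪ (volume : Measure (EuclideanSpace ℝ (Fin d))))
    (hν : ν ≪ (volume : Measure (EuclideanSpace ℝ (Fin d))))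
    (hfin : ∃ γ₀ : Measure (EuclideanSpace ℝ (Fin d) × EuclideanSpace ℝ (Fin d)),
      IsFiniteMeasure γ₀ ∧ ETKL c Λ μ ν γ₀ < ⊤)
    (γt : Measure (EuclideanSpace ℝ (Fin d) × EuclideanSpace ℝ (Fin d)))
    [IsFiniteMeasure γt]
    (hγt : ∀ γ' : Measure (EuclideanSpace ℝ (Fin d) × EuclideanSpace ℝ (Fin d)),
      IsFiniteMeasure γ' → ETKL c Λ μ ν γt ≤ ETKL c Λ μ ν γ')
    (Emin : ℝ≥0∞)
    (hEmin : Emin = ⨅ (γ : Measure (EuclideanSpace ℝ (Fin d) × EuclideanSpace ℝ (Fin d)))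
      (_ : IsProbabilityMeasure γ), ETKL c Λ μ ν γ) :
    ∃ γ : Measure (EuclideanSpace ℝ (Fin d) × EuclideanSpace ℝ (Fin d)),
      IsProbabilityMeasure γ ∧
      ETKL c Λ μ ν γ = Emin ∧
      γt = (ENNReal.ofReal (Real.exp (-(Emin.toReal) / (2 * Λ)))) • γ := by
  have hcont : Continuous h :=
    continuousOn_univ.1 (hhconv.convexOn.continuousOn isOpen_univ)
  obtain ⟨γ₁, hγ₁, hE₁⟩ := exists_prob_finite h hcont c hch Λ hΛ μ ν
  have hEt : ETKL c Λ μ ν γt ≠ ⊤ :=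
    ne_top_of_le_ne_top hE₁ (hγt γ₁ inferInstance)
  -- comparison of `γt` with multiples of probability measures
  have key : ∀ γ' : Measure (EuclideanSpace ℝ (Fin d) × EuclideanSpace ℝ (Fin d)),
      IsProbabilityMeasure γ' → ETKL c Λ μ ν γ' ≠ ⊤ → ∀ s : ℝ≥0,
      (ETKL c Λ μ ν γt).toReal ≤ s * (ETKL c Λ μ ν γ').toReal + 2 * Λ * (1 - s)
        + 2 * Λ * (s * Real.log s) := by
    intro γ' hγ' hE' s
    obtain ⟨q1, q2⟩ := ETKL_smul c Λ hΛ μ ν γ' hE' s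
    have := ENNReal.toReal_mono q1 (hγt (s • γ') inferInstance)
    rw [q2, probReal_univ] at this
    linarith
  -- the optimal multiple
  have key2 : ∀ γ' : Measure (EuclideanSpace ℝ (Fin d) × EuclideanSpace ℝ (Fin d)),
      IsProbabilityMeasure γ' → ETKL c Λ μ ν γ' ≠ ⊤ →
      (ETKL c Λ μ ν γt).toReal ≤
        2 * Λ * (1 - Real.exp (-(ETKL c Λ μ ν γ').toReal / (2 * Λ))) := by
    intro γ' hγ' hE'
    have := key γ' hγ' hE' ⟨Real.exp (-(ETKL c Λ μ ν γ').toReal / (2 * Λ)), (Real.exp_pos _).le⟩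
    change _ ≤ Real.exp _ * _ + 2 * Λ * (1 - Real.exp _)
      + 2 * Λ * (Real.exp _ * Real.log (Real.exp _)) at this
    rw [Real.log_exp] at this
    refine this.trans (le_of_eq ?_)
    field_simp
    ring
  have hγt0 : γt ≠ 0 := by
    intro h0
    have q := (ETKL_smul c Λ hΛ μ ν γ₁ hE₁ 0).2
    have q2 := key2 γ₁ hγ₁ hE₁
    rw [h0] at q2
    simp only [zero_smul, NNReal.coe_zero] at q
    rw [q] at q2
    have := mul_pos hΛ (Real.exp_pos (-(ETKL c Λ μ ν γ₁).toReal / (2 * Λ)))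
    simp at q2
    linarith
  have hm : γt Set.univ ≠ 0 := by simpa using hγt0
  have hm' : γt Set.univ ≠ ⊤ := measure_ne_top _ _
  obtain ⟨M, hM⟩ : ∃ M : ℝ≥0, (M : ℝ≥0∞) = γt Set.univ := ⟨_, ENNReal.coe_toNNReal hm'⟩
  have hM0 : M ≠ 0 := by
    rintro rfl
    exact hm (by simpa using hM.symm)
  have hMpos : (0 : ℝ) < M := by positivity
  obtain ⟨γ, hγdef⟩ : ∃ γ, γ = M⁻¹ • γt := ⟨_, rfl⟩
  have hγp : IsProbabilityMeasure γ := by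
    constructor
    rw [hγdef, Measure.smul_apply, ENNReal.smul_def, ENNReal.coe_inv hM0, hM,
      smul_eq_mul, ENNReal.inv_mul_cancel hm hm']
  have hγtM : γt = M • γ := by
    rw [hγdef, smul_smul, mul_inv_cancel₀ hM0, one_smul]
  have hEγ : ETKL c Λ μ ν γ ≠ ⊤ := by
    rw [hγdef]
    exact (ETKL_smul c Λ hΛ μ ν γt hEt _).1
  have hval : (ETKL c Λ μ ν γt).toReal = M * (ETKL c Λ μ ν γ).toReal + 2 * Λ * (1 - M)
      + 2 * Λ * (M * Real.log M) := by
    have := (ETKL_smul c Λ hΛ μ ν γ hEγ M).2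
    rw [← hγtM, probReal_univ] at this
    linarith
  have hmin : ETKL c Λ μ ν γ = Emin := by
    rw [hEmin]
    refine le_antisymm (le_iInf₂ fun γ' hγ' => ?_) (iInf₂_le γ hγp)
    by_cases hE' : ETKL c Λ μ ν γ' = ⊤
    · rw [hE']
      exact le_top
    rw [← ENNReal.toReal_le_toReal hEγ hE']
    have := key γ' hγ' hE' M
    rw [hval] at this
    exact le_of_mul_le_mul_left (by linarith) hMpos
  refine ⟨γ, hγp, hmin, ?_⟩
  have hopt := key2 γ hγp hEγ
  rw [hval, hmin] at hopt
  set e := Emin.toReal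
  set t := Real.exp (-e / (2 * Λ)) with ht
  have htpos : 0 < t := Real.exp_pos _
  have hlog : 2 * Λ * Real.log t = -e := by
    rw [ht, Real.log_exp]
    field_simp
  have hkl : t * InformationTheory.klFun (M / t) ≤ 0 := by
    rw [InformationTheory.klFun_apply, Real.log_div hMpos.ne' htpos.ne']
    have e1 : t * (M / t * (Real.log M - Real.log t) + 1 - M / t)
        = M * (Real.log M - Real.log t) + t - M := by
      field_simp
    rw [e1]
    have e2 : 2 * Λ * (M * (Real.log M - Real.log t) + t - M) ≤ 0 := by
      have e3 : 2 * Λ * (M * (Real.log M - Real.log t) + t - M)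
        = 2 * Λ * (M * Real.log M) - M * (2 * Λ * Real.log t) + 2 * Λ * t - 2 * Λ * M := by ring
      rw [e3, hlog]
      linarith
    by_contra! hc
    have := mul_pos (mul_pos two_pos hΛ) hc
    linarith
  have hdiv : (0 : ℝ) ≤ M / t := by positivity
  have hz : InformationTheory.klFun (M / t) = 0 := by
    refine le_antisymm ?_ (InformationTheory.klFun_nonneg hdiv)
    by_contra! hc
    have := mul_pos htpos hc
    linarith
  have h1 := (InformationTheory.klFun_eq_zero_iff hdiv).1 hz
  have hMt : (M : ℝ) = t := by
    field_simp at h1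
    exact h1
  rw [← hMt, ENNReal.ofReal_coe_nnreal]
  exact hγtM
end

section
/- The constrained entropy transport problem inf over γ ∈ P(ℝ^d × ℝ^d) of E_{Λ,KL}(γ|μ,ν) admits a unique optimal solution. -/
open MeasureTheory ENNReal Filter
open scoped Classical NNReal

open InformationTheory in
lemma kl_tangent {a m : ℝ} (ha : 0 ≤ a) (hm : 0 < m) :
    (√a - √m) ^ 2 ≤ a * Real.log a - a * Real.log m - a + m := by
  rcases ha.eq_or_lt with rfl | ha
  · simp [Real.sq_sqrt hm.le]
  · have h1 : Real.log (√m / √a) ≤ √m / √a - 1 := Real.log_le_sub_one_of_pos (by positivity)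
    rw [Real.log_div (by positivity) (by positivity), Real.log_sqrt hm.le, Real.log_sqrt ha.le] at h1
    have h2 : a * (√m / √a) = √a * √m := by
      have : √a ≠ 0 := by positivity
      field_simp
      rw [Real.sq_sqrt ha.le]
    have h3 := mul_le_mul_of_nonneg_left h1 ha.le
    have h4 := Real.sq_sqrt ha.le
    have h5 := Real.sq_sqrt hm.le
    nlinarith

open InformationTheory in
lemma kl_gap {a b ε : ℝ} (ha : 0 ≤ a) (hb : 0 ≤ b) (hε : 0 < ε) :
    |a - b| + (1 / (4 * ε)) * (2 * klFun ((a + b) / 2))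
      ≤ 4 * ε * (a + b) + (1 / (4 * ε)) * (klFun a + klFun b) := by
  rcases (add_nonneg ha hb).eq_or_lt with h0 | h0
  · have : a = 0 := by linarith
    have : b = 0 := by linarith
    subst_vars
    simp
    ring_nf
    rfl
  set m := (a + b) / 2 with hm
  have hm0 : 0 < m := by positivity
  have h1 := kl_tangent ha hm0
  have h2 := kl_tangent hb hm0
  have aux : ∀ x : ℝ, 0 ≤ x → |x - m| ≤ 2 * ε * (x + m) + (1 / (4 * ε)) * (√x - √m) ^ 2 := by
    intro x hx
    have e1 : x - m = (√x - √m) * (√x + √m) := by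
      nlinarith [Real.sq_sqrt hx, Real.sq_sqrt hm0.le]
    have e2 : (√x + √m) ^ 2 ≤ 2 * (x + m) := by
      nlinarith [Real.sq_sqrt hx, Real.sq_sqrt hm0.le, sq_nonneg (√x - √m)]
    rw [e1, abs_mul, abs_of_nonneg (by positivity : 0 ≤ √x + √m)]
    set u := √x + √m
    rw [← sq_abs (√x - √m)]
    set w := |√x - √m|
    have e3 : w * u ≤ ε * u ^ 2 + (1 / (4 * ε)) * w ^ 2 := by
      have : ε * u ^ 2 + (1 / (4 * ε)) * w ^ 2 - w * u = (2 * ε * u - w) ^ 2 / (4 * ε) := by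
        field_simp; ring
      have : 0 ≤ (2 * ε * u - w) ^ 2 / (4 * ε) := by positivity
      linarith
    nlinarith
  have a1 := aux a ha
  have a2 := aux b hb
  have h3 : |a - b| ≤ |a - m| + |b - m| := by
    rw [abs_sub_comm b m]; exact abs_sub_le a m b
  have h4 : (√a - √m) ^ 2 + (√b - √m) ^ 2 ≤ klFun a + klFun b - 2 * klFun m := by
    simp only [klFun_apply]
    have : a + b = 2 * m := by rw [hm]; ring
    have : (a + b) * Real.log m = 2 * m * Real.log m := by rw [this]
    linarith
  have h5 := mul_le_mul_of_nonneg_left h4 (by positivity : 0 ≤ 1 / (4 * ε))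
  have h6 : 2 * ε * (a + m) + 2 * ε * (b + m) = 4 * ε * (a + b) := by rw [hm]; ring
  linarith

open InformationTheory in
lemma Fkl_eq {r : ℝ≥0∞} (hr : r ≠ ⊤) : Fkl r = ENNReal.ofReal (klFun r.toReal) := by
  simp only [Fkl, hr, if_false, klFun_apply]
  congr 1; ring

open InformationTheory in
lemma measurable_Fkl : Measurable Fkl := by
  unfold Fkl
  refine Measurable.ite (measurableSet_singleton _) measurable_const ?_
  have : Measurable (fun r : ℝ≥0∞ => ENNReal.ofReal (klFun r.toReal)) :=
    (measurable_klFun.comp ENNReal.measurable_toReal).ennreal_ofReal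
  convert this using 3
  rw [klFun_apply]; ring

open InformationTheory in
lemma Fkl_gap {a b : ℝ≥0∞} (ha : a ≠ ⊤) (hb : b ≠ ⊤) {ε : ℝ} (hε : 0 < ε) :
    ENNReal.ofReal |a.toReal - b.toReal| + ENNReal.ofReal (1 / (4 * ε)) * (2 * Fkl (2⁻¹ * (a + b)))
      ≤ ENNReal.ofReal (4 * ε) * (a + b) + ENNReal.ofReal (1 / (4 * ε)) * (Fkl a + Fkl b) := by
  have hab : (2⁻¹ * (a + b)) ≠ ⊤ := by finiteness
  rw [Fkl_eq ha, Fkl_eq hb, Fkl_eq hab]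
  have h := kl_gap (a := a.toReal) (b := b.toReal) toReal_nonneg toReal_nonneg hε
  have e : (2⁻¹ * (a + b)).toReal = (a.toReal + b.toReal) / 2 := by
    rw [ENNReal.toReal_mul, ENNReal.toReal_add ha hb]; simp; ring
  rw [e]
  have k0 := klFun_nonneg (x := (a.toReal + b.toReal) / 2) (by positivity)
  have k1 := klFun_nonneg (x := a.toReal) (by positivity)
  have k2 := klFun_nonneg (x := b.toReal) (by positivity)
  have ea : a + b = ENNReal.ofReal (a.toReal + b.toReal) := by
    rw [ENNReal.ofReal_add (by positivity) (by positivity), ofReal_toReal ha, ofReal_toReal hb]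
  have e2 : (2 : ℝ≥0∞) = ENNReal.ofReal 2 := by simp
  rw [ea, e2, ← ENNReal.ofReal_add k1 k2, ← ENNReal.ofReal_mul (by positivity),
    ← ENNReal.ofReal_mul (by positivity), ← ENNReal.ofReal_mul (by positivity),
    ← ENNReal.ofReal_mul (by positivity), ← ENNReal.ofReal_add (by positivity) (by positivity),
    ← ENNReal.ofReal_add (by positivity) (by positivity)]
  exact ENNReal.ofReal_le_ofReal h

lemma div_gap {α : Type*} [MeasurableSpace α] (μ σ₁ σ₂ : Measure α) [IsFiniteMeasure μ]
    [IsProbabilityMeasure σ₁] [IsProbabilityMeasure σ₂] (h₁ : σ₁ ≪ μ) (h₂ : σ₂ ≪ μ)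
    {ε : ℝ} (hε : 0 < ε) :
    ∫⁻ x, ENNReal.ofReal |(σ₁.rnDeriv μ x).toReal - (σ₂.rnDeriv μ x).toReal| ∂μ
      + ENNReal.ofReal (1 / (4 * ε)) * (2 * divergenceF Fkl ((2⁻¹ : ℝ≥0∞) • (σ₁ + σ₂)) μ)
    ≤ ENNReal.ofReal (8 * ε)
      + ENNReal.ofReal (1 / (4 * ε)) * (divergenceF Fkl σ₁ μ + divergenceF Fkl σ₂ μ) := by
  have h₃ : (2⁻¹ : ℝ≥0∞) • (σ₁ + σ₂) ≪ μ := by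
    refine Measure.AbsolutelyContinuous.smul_left ?_ _
    intro s hs
    simp [h₁ hs, h₂ hs]
  simp only [divergenceF, h₁, h₂, h₃, if_true]
  have m1 := Measure.measurable_rnDeriv σ₁ μ
  have m2 := Measure.measurable_rnDeriv σ₂ μ
  have hae : ∀ᵐ x ∂μ, ((2⁻¹ : ℝ≥0∞) • (σ₁ + σ₂)).rnDeriv μ x
      = 2⁻¹ * (σ₁.rnDeriv μ x + σ₂.rnDeriv μ x) := by
    filter_upwards [Measure.rnDeriv_smul_left_of_ne_top (σ₁ + σ₂) μ (r := 2⁻¹) (by simp),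
      Measure.rnDeriv_add σ₁ σ₂ μ] with x hx hx'
    rw [hx, Pi.smul_apply, hx']; simp
  have hae' : ∫⁻ x, Fkl (((2⁻¹ : ℝ≥0∞) • (σ₁ + σ₂)).rnDeriv μ x) ∂μ
      = ∫⁻ x, Fkl (2⁻¹ * (σ₁.rnDeriv μ x + σ₂.rnDeriv μ x)) ∂μ :=
    lintegral_congr_ae (hae.mono fun x hx => by simp only [hx])
  rw [hae']
  have i1 : ∫⁻ x, σ₁.rnDeriv μ x ∂μ = 1 := by rw [Measure.lintegral_rnDeriv h₁]; simp
  have i2 : ∫⁻ x, σ₂.rnDeriv μ x ∂μ = 1 := by rw [Measure.lintegral_rnDeriv h₂]; simp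
  have e8 : ENNReal.ofReal (8 * ε) = ENNReal.ofReal (4 * ε) *
      ∫⁻ x, (σ₁.rnDeriv μ x + σ₂.rnDeriv μ x) ∂μ := by
    rw [lintegral_add_left m1, i1, i2, one_add_one_eq_two, ← ENNReal.ofReal_ofNat 2,
      ← ENNReal.ofReal_mul (by positivity)]
    congr 1; ring
  have mf1 := measurable_Fkl.comp m1
  have mf2 := measurable_Fkl.comp m2
  have mf3 : Measurable (fun x => Fkl (2⁻¹ * (σ₁.rnDeriv μ x + σ₂.rnDeriv μ x))) :=
    measurable_Fkl.comp ((m1.add m2).const_mul 2⁻¹)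
  have m12 : Measurable (fun x => σ₁.rnDeriv μ x + σ₂.rnDeriv μ x) := m1.add m2
  have mf12 : Measurable (fun x => Fkl (σ₁.rnDeriv μ x) + Fkl (σ₂.rnDeriv μ x)) := mf1.add mf2
  rw [e8]
  rw [← lintegral_const_mul _ mf3, ← lintegral_const_mul _ (mf3.const_mul 2),
    ← lintegral_const_mul _ m12]
  have e9 : ∫⁻ x, Fkl (σ₁.rnDeriv μ x) ∂μ + ∫⁻ x, Fkl (σ₂.rnDeriv μ x) ∂μ
    = ∫⁻ x, (Fkl (σ₁.rnDeriv μ x) + Fkl (σ₂.rnDeriv μ x)) ∂μ := (lintegral_add_left mf1 _).symm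
  rw [e9, ← lintegral_const_mul _ mf12, ← lintegral_add_right _ ((mf3.const_mul 2).const_mul _),
    ← lintegral_add_right _ (mf12.const_mul _)]
  refine lintegral_mono_ae ?_
  filter_upwards [Measure.rnDeriv_ne_top σ₁ μ, Measure.rnDeriv_ne_top σ₂ μ] with x hx1 hx2
  exact Fkl_gap hx1 hx2 hε

/-- L1 distance of densities. -/
noncomputable def l1d {α : Type*} [MeasurableSpace α] (μ σ₁ σ₂ : Measure α) : ℝ≥0∞ :=
  ∫⁻ x, ENNReal.ofReal |(σ₁.rnDeriv μ x).toReal - (σ₂.rnDeriv μ x).toReal| ∂μ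

lemma ac_of_div {α : Type*} [MeasurableSpace α] {F : ℝ≥0∞ → ℝ≥0∞} {μ σ : Measure α}
    (h : divergenceF F σ μ ≠ ⊤) : σ ≪ μ := by
  by_contra hc
  simp [divergenceF, hc] at h

section ET
variable {d : ℕ} {c : EuclideanSpace ℝ (Fin d) × EuclideanSpace ℝ (Fin d) → ℝ≥0∞} {Λ : ℝ}
  {μ ν : Measure (EuclideanSpace ℝ (Fin d))}

lemma ETKL_parts (hΛ : 0 < Λ) {γ : Measure (EuclideanSpace ℝ (Fin d) × EuclideanSpace ℝ (Fin d))}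
    (h : ETKL c Λ μ ν γ ≠ ⊤) : ∫⁻ p, c p ∂γ ≠ ⊤ ∧ divergenceF Fkl (γ.map Prod.fst) μ ≠ ⊤ ∧
      divergenceF Fkl (γ.map Prod.snd) ν ≠ ⊤ := by
  simp only [ETKL, ne_eq, ENNReal.add_eq_top, not_or, ENNReal.mul_eq_top, ofReal_eq_zero, not_le,
    hΛ, ofReal_ne_top, true_and, false_and, or_false] at h
  exact ⟨h.1.1, h.1.2, h.2⟩

lemma key_gap [IsProbabilityMeasure μ] [IsProbabilityMeasure ν] (hΛ : 0 < Λ)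
    {γ₁ γ₂ : Measure (EuclideanSpace ℝ (Fin d) × EuclideanSpace ℝ (Fin d))}
    [IsProbabilityMeasure γ₁] [IsProbabilityMeasure γ₂]
    {m : ℝ≥0∞} (hm : m ≠ ⊤) {δ ε : ℝ} (hδ : 0 ≤ δ) (hε : 0 < ε)
    (hmin : ∀ γ' : Measure (EuclideanSpace ℝ (Fin d) × EuclideanSpace ℝ (Fin d)),
        IsProbabilityMeasure γ' → m ≤ ETKL c Λ μ ν γ')
    (h₁ : ETKL c Λ μ ν γ₁ ≤ m + ENNReal.ofReal δ) (h₂ : ETKL c Λ μ ν γ₂ ≤ m + ENNReal.ofReal δ) :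
    l1d μ (γ₁.map Prod.fst) (γ₂.map Prod.fst) + l1d ν (γ₁.map Prod.snd) (γ₂.map Prod.snd)
      ≤ ENNReal.ofReal (16 * ε + δ / (2 * ε * Λ)) := by
  obtain ⟨c1, d1, e1⟩ := ETKL_parts hΛ (ne_top_of_le_ne_top (by finiteness) h₁)
  obtain ⟨c2, d2, e2⟩ := ETKL_parts hΛ (ne_top_of_le_ne_top (by finiteness) h₂)
  have : IsProbabilityMeasure (γ₁.map Prod.fst) := Measure.isProbabilityMeasure_map (by fun_prop)
  have : IsProbabilityMeasure (γ₂.map Prod.fst) := Measure.isProbabilityMeasure_map (by fun_prop)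
  have : IsProbabilityMeasure (γ₁.map Prod.snd) := Measure.isProbabilityMeasure_map (by fun_prop)
  have : IsProbabilityMeasure (γ₂.map Prod.snd) := Measure.isProbabilityMeasure_map (by fun_prop)
  have g1 := div_gap μ (γ₁.map Prod.fst) (γ₂.map Prod.fst) (ac_of_div d1) (ac_of_div d2) hε
  have g2 := div_gap ν (γ₁.map Prod.snd) (γ₂.map Prod.snd) (ac_of_div e1) (ac_of_div e2) hε
  have hp : IsProbabilityMeasure ((2⁻¹ : ℝ≥0∞) • (γ₁ + γ₂)) := by
    constructor
    simp [ENNReal.inv_two_add_inv_two]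
  have hm3 := hmin _ hp
  have mf : ((2⁻¹ : ℝ≥0∞) • (γ₁ + γ₂)).map Prod.fst
      = (2⁻¹ : ℝ≥0∞) • (γ₁.map Prod.fst + γ₂.map Prod.fst) := by
    rw [Measure.map_smul, Measure.map_add _ _ measurable_fst]
  have ms : ((2⁻¹ : ℝ≥0∞) • (γ₁ + γ₂)).map Prod.snd
      = (2⁻¹ : ℝ≥0∞) • (γ₁.map Prod.snd + γ₂.map Prod.snd) := by
    rw [Measure.map_smul, Measure.map_add _ _ measurable_snd]
  simp only [ETKL] at hm3 h₁ h₂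
  rw [mf, ms, lintegral_smul_measure, lintegral_add_measure] at hm3
  change l1d μ _ _ + _ ≤ _ at g1
  change l1d ν _ _ + _ ≤ _ at g2
  generalize l1d μ (γ₁.map Prod.fst) (γ₂.map Prod.fst) = I1 at *
  generalize l1d ν (γ₁.map Prod.snd) (γ₂.map Prod.snd) = I2 at *
  generalize divergenceF Fkl ((2⁻¹ : ℝ≥0∞) • (γ₁.map Prod.fst + γ₂.map Prod.fst)) μ = D3 at *
  generalize divergenceF Fkl ((2⁻¹ : ℝ≥0∞) • (γ₁.map Prod.snd + γ₂.map Prod.snd)) ν = E3 at *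
  generalize divergenceF Fkl (γ₁.map Prod.fst) μ = D1 at *
  generalize divergenceF Fkl (γ₂.map Prod.fst) μ = D2 at *
  generalize divergenceF Fkl (γ₁.map Prod.snd) ν = E1 at *
  generalize divergenceF Fkl (γ₂.map Prod.snd) ν = E2 at *
  generalize ∫⁻ p, c p ∂γ₁ = C1 at *
  generalize ∫⁻ p, c p ∂γ₂ = C2 at *
  have hI1 : I1 ≠ ⊤ := by
    refine ne_top_of_le_ne_top ?_ (le_self_add.trans g1); finiteness
  have hI2 : I2 ≠ ⊤ := by
    refine ne_top_of_le_ne_top ?_ (le_self_add.trans g2); finiteness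
  have hk : 0 < 1 / (4 * ε) := by positivity
  have hD3 : D3 ≠ ⊤ := by
    rintro rfl
    have := ne_top_of_le_ne_top (by finiteness) (le_add_self.trans g1)
    simp [ENNReal.mul_eq_top] at this
    linarith
  have hE3 : E3 ≠ ⊤ := by
    rintro rfl
    have := ne_top_of_le_ne_top (by finiteness) (le_add_self.trans g2)
    simp [ENNReal.mul_eq_top] at this
    linarith
  lift I1 to ℝ≥0 using hI1
  lift I2 to ℝ≥0 using hI2
  lift D3 to ℝ≥0 using hD3
  lift E3 to ℝ≥0 using hE3
  lift D1 to ℝ≥0 using d1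
  lift D2 to ℝ≥0 using d2
  lift E1 to ℝ≥0 using e1
  lift E2 to ℝ≥0 using e2
  lift C1 to ℝ≥0 using c1
  lift C2 to ℝ≥0 using c2
  lift m to ℝ≥0 using hm
  rw [← ENNReal.toReal_le_toReal (by finiteness) (by finiteness)] at g1 g2 h₁ h₂
  rw [← ENNReal.toReal_le_toReal (by finiteness) (by simp [ENNReal.mul_eq_top, ENNReal.add_eq_top])] at hm3
  rw [← ENNReal.toReal_le_toReal (by finiteness) (by finiteness)]
  have q0 : 0 ≤ 16 * ε + δ / (2 * ε * Λ) := by positivity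
  have q1 : 0 ≤ 8 * ε := by positivity
  simp (discharger := finiteness) only [ENNReal.toReal_add, ENNReal.toReal_mul, ENNReal.coe_toReal,
    ENNReal.toReal_ofReal hΛ.le, ENNReal.toReal_ofReal hk.le, ENNReal.toReal_ofReal hδ,
    ENNReal.toReal_ofReal q0, ENNReal.toReal_ofReal q1, ENNReal.toReal_ofNat, smul_eq_mul,
    ENNReal.toReal_inv] at *
  have s1 : Λ * (D1 + D2 + E1 + E2 : ℝ) ≤ Λ * (2 * D3 + 2 * E3) + 2 * δ := by linarith
  have s2 : (D1 + D2 + E1 + E2 : ℝ) ≤ (2 * D3 + 2 * E3) + 2 * δ / Λ := by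
    have : Λ * ((2 * D3 + 2 * E3) + 2 * δ / Λ) = Λ * (2 * D3 + 2 * E3) + 2 * δ := by field_simp
    rw [← this] at s1
    exact le_of_mul_le_mul_left s1 hΛ
  have s3 := mul_le_mul_of_nonneg_left s2 hk.le
  have s4 : 1 / (4 * ε) * (2 * δ / Λ) = δ / (2 * ε * Λ) := by field_simp; ring
  rw [mul_add (1 / (4 * ε)) (2 * (D3 : ℝ) + 2 * E3), s4] at s3
  linarith

end ET

lemma l1_limit {α : Type*} [MeasurableSpace α] {μ : Measure α} (r : ℕ → α → ℝ≥0∞)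
    (hr : ∀ n, Measurable (r n)) (hfin : ∀ n, ∀ᵐ x ∂μ, r n x ≠ ⊤) (h0 : ∫⁻ x, r 0 x ∂μ ≠ ⊤)
    (hsum : ∑' n, ∫⁻ x, ENNReal.ofReal |(r (n + 1) x).toReal - (r n x).toReal| ∂μ ≠ ⊤) :
    ∃ g R : α → ℝ≥0∞, Measurable g ∧ Measurable R ∧ ∫⁻ x, R x ∂μ ≠ ⊤ ∧
      (∀ᵐ x ∂μ, R x ≠ ⊤) ∧
      (∀ᵐ x ∂μ, ∀ n, r n x ≤ R x) ∧
      ∀ᵐ x ∂μ, Tendsto (fun n => r n x) atTop (nhds (g x)) := by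
  have md : ∀ n, Measurable (fun x => ENNReal.ofReal |(r (n + 1) x).toReal - (r n x).toReal|) := by
    intro n
    have h1 := (hr (n+1)).ennreal_toReal
    have h2 := (hr n).ennreal_toReal
    have h3 : Measurable (fun x => |(r (n + 1) x).toReal - (r n x).toReal|) := (h1.sub h2).norm
    exact h3.ennreal_ofReal
  let R : α → ℝ≥0∞ := fun x => r 0 x + ∑' n, ENNReal.ofReal |(r (n + 1) x).toReal - (r n x).toReal|
  have mR : Measurable R := (hr 0).add (Measurable.tsum md)
  have iR : ∫⁻ x, R x ∂μ ≠ ⊤ := by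
    simp only [R]
    rw [lintegral_add_left (hr 0), lintegral_tsum (fun n => (md n).aemeasurable)]
    finiteness
  have aR : ∀ᵐ x ∂μ, R x ≠ ⊤ := (ae_lt_top mR iR).mono fun x hx => hx.ne
  have aF : ∀ᵐ x ∂μ, ∀ n, r n x ≠ ⊤ := ae_all_iff.2 hfin
  refine ⟨fun x => liminf (fun n => r n x) atTop, R, Measurable.liminf hr, mR, iR, aR, ?_, ?_⟩
  · filter_upwards [aF] with x hx n
    have : ∀ n, r n x ≤ r 0 x +
        ∑ k ∈ Finset.range n, ENNReal.ofReal |(r (k + 1) x).toReal - (r k x).toReal| := by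
      intro n
      induction n with
      | zero => simp
      | succ n ih =>
        rw [Finset.sum_range_succ, ← add_assoc]
        refine le_trans ?_ (add_le_add_left ih _)
        rw [← ENNReal.toReal_le_toReal (hx (n+1)) (by have := hx n; finiteness),
          ENNReal.toReal_add (hx n) (by finiteness), ENNReal.toReal_ofReal (by positivity)]
        have := le_abs_self ((r (n + 1) x).toReal - (r n x).toReal)
        linarith
    exact (this n).trans (add_le_add_right (ENNReal.sum_le_tsum _) _)
  · filter_upwards [aF, aR] with x hx hR
    have hs : ∑' n, ENNReal.ofReal |(r (n + 1) x).toReal - (r n x).toReal| ≠ ⊤ :=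
      ne_top_of_le_ne_top hR le_add_self
    have hsum : Summable (fun n => dist (r n x).toReal (r n.succ x).toReal) := by
      have := ENNReal.summable_toReal hs
      refine this.congr fun n => ?_
      rw [ENNReal.toReal_ofReal (by positivity), Real.dist_eq, abs_sub_comm]
    obtain ⟨l, hl⟩ := cauchySeq_tendsto_of_complete (cauchySeq_of_summable_dist hsum)
    have h2 : Tendsto (fun n => r n x) atTop (nhds (ENNReal.ofReal l)) := by
      refine (ENNReal.tendsto_ofReal hl).congr fun n => ENNReal.ofReal_toReal (hx n)
    rw [h2.liminf_eq]
    exact h2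

lemma ennreal_liminf_add (u v : ℕ → ℝ≥0∞) :
    liminf u atTop + liminf v atTop ≤ liminf (fun n => u n + v n) atTop := by
  simp only [liminf_eq_iSup_iInf_of_nat]
  rw [ENNReal.iSup_add_iSup_of_monotone]
  · refine iSup_mono fun n => le_iInf₂ fun i hi => add_le_add (iInf₂_le i hi) (iInf₂_le i hi)
  · intro a b hab
    exact le_iInf₂ fun i hi => iInf₂_le i (hab.trans hi)
  · intro a b hab
    exact le_iInf₂ fun i hi => iInf₂_le i (hab.trans hi)

open InformationTheory in
lemma Fkl_tendsto {r : ℕ → ℝ≥0∞} {g : ℝ≥0∞} (hr : ∀ n, r n ≠ ⊤) (hg : g ≠ ⊤)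
    (h : Tendsto r atTop (nhds g)) : Tendsto (fun n => Fkl (r n)) atTop (nhds (Fkl g)) := by
  simp only [Fkl_eq (hr _), Fkl_eq hg]
  exact ENNReal.tendsto_ofReal ((continuous_klFun.tendsto _).comp ((ENNReal.tendsto_toReal hg).comp h))

lemma marg_limit {X : Type*} [MeasurableSpace X] [MetricSpace X] [BorelSpace X]
    (μ : Measure X) [IsProbabilityMeasure μ] (s : ℕ → Measure X) [∀ n, IsProbabilityMeasure (s n)]
    (hac : ∀ n, s n ≪ μ) (hsum : ∑' n, l1d μ (s (n + 1)) (s n) ≠ ⊤) :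
    (∃ ρ : Measure X, IsFiniteMeasure ρ ∧ ∀ n, s n ≤ ρ) ∧
    ∀ φ : ℕ → ℕ, StrictMono φ → ∀ σ : Measure X, IsProbabilityMeasure σ →
      (∀ U, IsOpen U → σ U ≤ liminf (fun n => s (φ n) U) atTop) →
      divergenceF Fkl σ μ ≤ liminf (fun n => divergenceF Fkl (s (φ n)) μ) atTop := by
  obtain ⟨g, R, mg, mR, iR, aR, hle, hlim⟩ := l1_limit (μ := μ) (fun n => (s n).rnDeriv μ)
    (fun n => Measure.measurable_rnDeriv _ _) (fun n => Measure.rnDeriv_ne_top _ _)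
    (by rw [Measure.lintegral_rnDeriv (hac 0)]; simp) hsum
  have hs : ∀ n, μ.withDensity ((s n).rnDeriv μ) = s n :=
    fun n => Measure.withDensity_rnDeriv_eq _ _ (hac n)
  refine ⟨⟨μ.withDensity R, isFiniteMeasure_withDensity iR, fun n => ?_⟩, ?_⟩
  · rw [← hs n]
    exact withDensity_mono (hle.mono fun x hx => hx n)
  intro φ hφ σ hσ hopen
  have hset : ∀ A, MeasurableSet A →
      Tendsto (fun n => s (φ n) A) atTop (nhds (μ.withDensity g A)) := by
    intro A hA
    rw [withDensity_apply _ hA]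
    have := tendsto_lintegral_of_dominated_convergence (μ := μ.restrict A)
      (F := fun n => (s n).rnDeriv μ) (f := g) R
      (fun n => Measure.measurable_rnDeriv _ _)
      (fun n => ae_restrict_of_ae (hle.mono fun x hx => hx n))
      (ne_top_of_le_ne_top iR (setLIntegral_le_lintegral _ _))
      (ae_restrict_of_ae hlim)
    have h2 : Tendsto (fun n => s n A) atTop (nhds (∫⁻ a in A, g a ∂μ)) := by
      refine this.congr fun n => ?_
      rw [← withDensity_apply _ hA, hs n]
    exact h2.comp hφ.tendsto_atTop
  have hg1 : IsProbabilityMeasure (μ.withDensity g) := by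
    constructor
    refine tendsto_nhds_unique (hset Set.univ MeasurableSet.univ) ?_
    simp
  have hσg : σ = μ.withDensity g := by
    refine Measure.eq_of_le_of_isProbabilityMeasure ?_
    refine Measure.le_iff'.2 fun A => ?_
    rw [Set.measure_eq_iInf_isOpen A (μ.withDensity g)]
    refine le_iInf fun U => le_iInf fun hAU => le_iInf fun hU => ?_
    calc σ A ≤ σ U := measure_mono hAU
      _ ≤ _ := hopen U hU
      _ = _ := (hset U hU.measurableSet).liminf_eq
  have hσac : σ ≪ μ := by rw [hσg]; exact withDensity_absolutelyContinuous _ _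
  have hd : divergenceF Fkl σ μ = ∫⁻ x, Fkl (g x) ∂μ := by
    simp only [divergenceF, hσac, if_true]
    refine lintegral_congr_ae ?_
    rw [hσg]
    filter_upwards [Measure.rnDeriv_withDensity μ mg] with x hx
    rw [hx]
  have hd' : ∀ n, divergenceF Fkl (s (φ n)) μ = ∫⁻ x, Fkl ((s (φ n)).rnDeriv μ x) ∂μ := by
    intro n
    simp only [divergenceF, hac, if_true]
  simp only [hd, hd']
  refine le_trans ?_ (lintegral_liminf_le fun n =>
    measurable_Fkl.comp (Measure.measurable_rnDeriv (s (φ n)) μ))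
  refine lintegral_mono_ae ?_
  filter_upwards [hle, hlim, aR] with x h1 h2 h3
  have hgx : g x ≤ R x := le_of_tendsto' h2 h1
  have := (Fkl_tendsto (fun n => ne_top_of_le_ne_top h3 (h1 n)) (ne_top_of_le_ne_top h3 hgx) h2).comp
    hφ.tendsto_atTop
  exact this.liminf_eq.ge

lemma tight_of_le {X : Type*} [MeasurableSpace X] [TopologicalSpace X] {S : Set (Measure X)}
    {ρ : Measure X} (hρ : IsTightMeasureSet {ρ}) (h : ∀ s ∈ S, s ≤ ρ) : IsTightMeasureSet S := by
  rw [isTightMeasureSet_iff_exists_isCompact_measure_compl_le] at hρ ⊢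
  intro ε hε
  obtain ⟨K, hK, h2⟩ := hρ ε hε
  exact ⟨K, hK, fun s hs => (h s hs _).trans (h2 ρ rfl)⟩

section ET
variable {d : ℕ} {Λ : ℝ} {μ ν : Measure (EuclideanSpace ℝ (Fin d))}

lemma exists_min [IsProbabilityMeasure μ] [IsProbabilityMeasure ν] (hΛ : 0 < Λ)
    (f : EuclideanSpace ℝ (Fin d) × EuclideanSpace ℝ (Fin d) → ℝ) (hf : Continuous f) (hf0 : 0 ≤ f)
    (hfin : ∃ γ : Measure (EuclideanSpace ℝ (Fin d) × EuclideanSpace ℝ (Fin d)),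
      IsProbabilityMeasure γ ∧ ETKL (fun p => ENNReal.ofReal (f p)) Λ μ ν γ ≠ ⊤) :
    ∃ γ : Measure (EuclideanSpace ℝ (Fin d) × EuclideanSpace ℝ (Fin d)),
      IsProbabilityMeasure γ ∧
      ∀ γ' : Measure (EuclideanSpace ℝ (Fin d) × EuclideanSpace ℝ (Fin d)),
        IsProbabilityMeasure γ' → ETKL (fun p => ENNReal.ofReal (f p)) Λ μ ν γ
          ≤ ETKL (fun p => ENNReal.ofReal (f p)) Λ μ ν γ' := by
  set E := ETKL (fun p => ENNReal.ofReal (f p)) Λ μ ν with hE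
  let m : ℝ≥0∞ := ⨅ γ : ProbabilityMeasure (EuclideanSpace ℝ (Fin d) × EuclideanSpace ℝ (Fin d)),
    E (γ : Measure _)
  obtain ⟨γ₀, hγ₀, hE₀⟩ := hfin
  have hmin : ∀ γ' : Measure (EuclideanSpace ℝ (Fin d) × EuclideanSpace ℝ (Fin d)),
      IsProbabilityMeasure γ' → m ≤ E γ' := fun γ' h' => iInf_le (fun γ :
        ProbabilityMeasure (EuclideanSpace ℝ (Fin d) × EuclideanSpace ℝ (Fin d)) =>
        E (γ : Measure _)) ⟨γ', h'⟩
  have hm : m ≠ ⊤ := ne_top_of_le_ne_top hE₀ (hmin γ₀ hγ₀)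
  have hseq : ∀ n : ℕ, ∃ γ : ProbabilityMeasure (EuclideanSpace ℝ (Fin d) × EuclideanSpace ℝ (Fin d)),
      E (γ : Measure _) < m + ENNReal.ofReal (Λ * ((1 / 2 : ℝ) ^ n) ^ 2) := by
    intro n
    refine iInf_lt_iff.1 (ENNReal.lt_add_right hm ?_)
    have : 0 < Λ * ((1 / 2 : ℝ) ^ n) ^ 2 := by positivity
    simpa using this
  choose G hG using hseq
  have hG' : ∀ n, E (G n : Measure _) ≠ ⊤ := fun n => ((hG n).trans (by finiteness)).ne
  let H : ℕ → Measure (EuclideanSpace ℝ (Fin d) × EuclideanSpace ℝ (Fin d)) := fun n => G n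
  have hH : ∀ n, IsProbabilityMeasure (H n) := fun n => (G n).2
  have hpm1 : ∀ n, IsProbabilityMeasure ((H n).map Prod.fst) :=
    fun n => Measure.isProbabilityMeasure_map (by fun_prop)
  have hpm2 : ∀ n, IsProbabilityMeasure ((H n).map Prod.snd) :=
    fun n => Measure.isProbabilityMeasure_map (by fun_prop)
  have hgap : ∀ n, l1d μ ((H (n+1)).map Prod.fst) ((H n).map Prod.fst)
      + l1d ν ((H (n+1)).map Prod.snd) ((H n).map Prod.snd)
      ≤ ENNReal.ofReal (17 * (1 / 2 : ℝ) ^ n) := by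
    intro n
    have hp : 0 < (1 / 2 : ℝ) ^ n := by positivity
    refine (key_gap hΛ hm (δ := Λ * ((1 / 2 : ℝ) ^ n) ^ 2) (ε := (1 / 2 : ℝ) ^ n) (by positivity)
      (by positivity) hmin ((hG (n+1)).le.trans ?_) (hG n).le).trans ?_
    · refine add_le_add_right (ENNReal.ofReal_le_ofReal ?_) _
      refine mul_le_mul_of_nonneg_left ?_ hΛ.le
      refine pow_le_pow_left₀ (by positivity) ?_ 2
      rw [pow_succ]; linarith
    · refine ENNReal.ofReal_le_ofReal ?_
      have : Λ * ((1 / 2 : ℝ) ^ n) ^ 2 / (2 * (1 / 2 : ℝ) ^ n * Λ) = (1 / 2 : ℝ) ^ n / 2 := by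
        field_simp
      rw [this]; linarith
  have hS : ∑' n : ℕ, ENNReal.ofReal (17 * (1 / 2 : ℝ) ^ n) ≠ ⊤ := by
    rw [← ENNReal.ofReal_tsum_of_nonneg (fun n => by positivity)
      (summable_geometric_two.mul_left 17)]
    simp
  obtain ⟨⟨ρ₁, hρ₁, hle₁⟩, hL₁⟩ := marg_limit μ (fun n => (H n).map Prod.fst)
    (fun n => ac_of_div (ETKL_parts hΛ (hG' n)).2.1)
    (ne_top_of_le_ne_top hS (ENNReal.tsum_le_tsum fun n => le_self_add.trans (hgap n)))
  obtain ⟨⟨ρ₂, hρ₂, hle₂⟩, hL₂⟩ := marg_limit ν (fun n => (H n).map Prod.snd)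
    (fun n => ac_of_div (ETKL_parts hΛ (hG' n)).2.2)
    (ne_top_of_le_ne_top hS (ENNReal.tsum_le_tsum fun n => le_add_self.trans (hgap n)))
  have htight : IsTightMeasureSet {((γ : ProbabilityMeasure _) :
      Measure (EuclideanSpace ℝ (Fin d) × EuclideanSpace ℝ (Fin d))) | γ ∈ Set.range G} := by
    refine IsTightMeasureSet.prodMk ?_ ?_
    · refine tight_of_le (ρ := ρ₁) isTightMeasureSet_singleton ?_
      rintro _ ⟨_, ⟨_, ⟨n, rfl⟩, rfl⟩, rfl⟩
      exact hle₁ n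
    · refine tight_of_le (ρ := ρ₂) isTightMeasureSet_singleton ?_
      rintro _ ⟨_, ⟨_, ⟨n, rfl⟩, rfl⟩, rfl⟩
      exact hle₂ n
  obtain ⟨γ, -, φ, hφ, hlim⟩ := (isCompact_closure_of_isTightMeasureSet htight).tendsto_subseq
    (x := G) (fun n => subset_closure ⟨n, rfl⟩)
  have hop : ∀ U : Set (EuclideanSpace ℝ (Fin d) × EuclideanSpace ℝ (Fin d)), IsOpen U →
      (γ : Measure _) U ≤ liminf (fun n => (H (φ n)) U) atTop := by
    intro U hU
    exact ProbabilityMeasure.le_liminf_measure_open_of_tendsto hlim hU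
  refine ⟨γ, inferInstance, fun γ' h' => le_trans ?_ (hmin γ' h')⟩
  have hc := lintegral_le_liminf_lintegral_of_forall_isOpen_measure_le_liminf_measure hf hf0 hop
  have hd1 := hL₁ φ hφ ((γ : Measure _).map Prod.fst)
    (Measure.isProbabilityMeasure_map measurable_fst.aemeasurable) (by
      intro U hU
      simp only [Measure.map_apply measurable_fst hU.measurableSet]
      exact hop _ (hU.preimage continuous_fst))
  have hd2 := hL₂ φ hφ ((γ : Measure _).map Prod.snd)
    (Measure.isProbabilityMeasure_map measurable_snd.aemeasurable) (by
      intro U hU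
      simp only [Measure.map_apply measurable_snd hU.measurableSet]
      exact hop _ (hU.preimage continuous_snd))
  have hlm : Tendsto (fun n => E (H (φ n))) atTop (nhds m) := by
    have h1 : Tendsto (fun n => E (H n)) atTop (nhds m) := by
      refine tendsto_of_tendsto_of_tendsto_of_le_of_le (g := fun _ => m)
        (h := fun n => m + ENNReal.ofReal (Λ * ((1 / 2 : ℝ) ^ n) ^ 2)) tendsto_const_nhds ?_
        (fun n => hmin _ inferInstance) (fun n => (hG n).le)
      have h2 : Tendsto (fun n : ℕ => Λ * ((1 / 2 : ℝ) ^ n) ^ 2) atTop (nhds (Λ * 0 ^ 2)) :=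
        ((_root_.tendsto_pow_atTop_nhds_zero_of_lt_one (by norm_num) (by norm_num)).pow 2).const_mul Λ
      have h3 := (ENNReal.tendsto_ofReal h2).const_add m
      simpa using h3
    exact h1.comp hφ.tendsto_atTop
  rw [← hlm.liminf_eq]
  have mul_liminf : ∀ u : ℕ → ℝ≥0∞, ENNReal.ofReal Λ * liminf u atTop
      ≤ liminf (fun n => ENNReal.ofReal Λ * u n) atTop := by
    intro u
    refine le_of_eq ?_
    exact (ENNReal.liminf_const_mul_of_ne_top (by simp)).symm
  simp only [hE, ETKL]
  calc _ ≤ _ := add_le_add (add_le_add hc ((mul_le_mul_right hd1 _).trans (mul_liminf _)))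
        ((mul_le_mul_right hd2 _).trans (mul_liminf _))
    _ ≤ _ := add_le_add_left (ennreal_liminf_add _ _) _
    _ ≤ _ := ennreal_liminf_add _ _
end ET

section OT
variable {d : ℕ}

/-- pairwise monotonicity via a.e. swapping -/
lemma swap_null {X : Type*} [MeasurableSpace X] {f : X × X → ℝ} (hf : Measurable f) (hf0 : ∀ p, 0 ≤ f p)
    (γ : Measure (X × X)) [IsProbabilityMeasure γ]
    (hfin : ∫⁻ p, ENNReal.ofReal (f p) ∂γ ≠ ⊤)
    (hopt : ∀ γ' : Measure (X × X), IsProbabilityMeasure γ' → γ'.map Prod.fst = γ.map Prod.fst →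
      γ'.map Prod.snd = γ.map Prod.snd →
      ∫⁻ p, ENNReal.ofReal (f p) ∂γ ≤ ∫⁻ p, ENNReal.ofReal (f p) ∂γ') :
    (γ.prod γ) {z | f (z.1.1, z.2.2) + f (z.2.1, z.1.2) < f z.1 + f z.2} = 0 := by
  set P := γ.prod γ with hP
  set S : Set ((X × X) × (X × X)) := {z | f (z.1.1, z.2.2) + f (z.2.1, z.1.2) < f z.1 + f z.2} with hS
  have m12 : Measurable (fun z : (X × X) × (X × X) => (z.1.1, z.2.2)) := by fun_prop
  have m21 : Measurable (fun z : (X × X) × (X × X) => (z.2.1, z.1.2)) := by fun_prop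
  have g1 : Measurable (fun z : (X × X) × (X × X) => f z.1) := hf.comp measurable_fst
  have g2 : Measurable (fun z : (X × X) × (X × X) => f z.2) := hf.comp measurable_snd
  have g12 : Measurable (fun z : (X × X) × (X × X) => f (z.1.1, z.2.2)) := hf.comp m12
  have g21 : Measurable (fun z : (X × X) × (X × X) => f (z.2.1, z.1.2)) := hf.comp m21
  have mS : MeasurableSet S := measurableSet_lt (g12.add g21) (g1.add g2)
  have hswap : MeasurePreserving (Prod.swap : (X × X) × (X × X) → _) P P :=
    ⟨measurable_swap, Measure.prod_swap⟩
  have hSswap : Prod.swap ⁻¹' S = S := by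
    ext z
    simp only [hS, Set.mem_preimage, Set.mem_ofPred_eq, Prod.fst_swap, Prod.snd_swap]
    rw [add_comm (f (z.2.1, z.1.2)), add_comm (f z.2)]
  have hint : ∀ g : (X × X) × (X × X) → ℝ≥0∞, Measurable g →
      ∫⁻ z in S, g z.swap ∂P = ∫⁻ z in S, g z ∂P := by
    intro g hg
    have := hswap.setLIntegral_comp_preimage mS hg
    rwa [hSswap] at this
  let T : (X × X) × (X × X) → X × X := fun z => if z ∈ S then (z.1.1, z.2.2) else z.1
  have mT : Measurable T := Measurable.ite mS m12 measurable_fst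
  have hpT : IsProbabilityMeasure (P.map T) := Measure.isProbabilityMeasure_map mT.aemeasurable
  have hfst : P.map Prod.fst = γ := by
    rw [hP]; exact Measure.fst_prod
  have h1 : (P.map T).map Prod.fst = γ.map Prod.fst := by
    conv_rhs => rw [← hfst]
    rw [Measure.map_map measurable_fst mT, Measure.map_map measurable_fst measurable_fst]
    congr 1
    ext z
    simp only [T, Function.comp]
    split_ifs <;> rfl
  have hsplit : ∀ g : X × X → ℝ≥0∞, Measurable g → ∫⁻ p, g p ∂(P.map T)
      = ∫⁻ z in S, g (z.1.1, z.2.2) ∂P + ∫⁻ z in Sᶜ, g z.1 ∂P := by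
    intro g hg
    rw [lintegral_map hg mT, ← lintegral_add_compl _ mS]
    congr 1
    · refine setLIntegral_congr_fun mS fun z hz => ?_
      simp only [T, hz, if_true]
    · refine setLIntegral_congr_fun mS.compl fun z hz => ?_
      simp only [T, Set.mem_compl_iff] at hz ⊢
      simp only [hz, if_false]
  have hsplit' : ∀ g : X × X → ℝ≥0∞, Measurable g → ∫⁻ p, g p ∂γ
      = ∫⁻ z in S, g z.1 ∂P + ∫⁻ z in Sᶜ, g z.1 ∂P := by
    intro g hg
    conv_lhs => rw [← hfst]
    rw [lintegral_map hg measurable_fst, ← lintegral_add_compl _ mS]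
  have h2 : (P.map T).map Prod.snd = γ.map Prod.snd := by
    refine Measure.ext_of_lintegral _ fun g hg => ?_
    rw [lintegral_map hg measurable_snd, lintegral_map hg measurable_snd,
      hsplit (fun p => g p.2) (hg.comp measurable_snd), hsplit' (fun p => g p.2) (hg.comp measurable_snd)]
    congr 1
    exact hint (fun z => g z.1.2) (hg.comp (measurable_snd.comp measurable_fst))
  have hle := hopt _ hpT h1 h2
  rw [hsplit _ hf.ennreal_ofReal] at hle
  have heq := hsplit' _ hf.ennreal_ofReal
  rw [heq] at hle hfin
  have hcfin : ∫⁻ z in Sᶜ, ENNReal.ofReal (f z.1) ∂P ≠ ⊤ := ne_top_of_le_ne_top hfin le_add_self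
  have hSfin : ∫⁻ z in S, ENNReal.ofReal (f z.1) ∂P ≠ ⊤ := ne_top_of_le_ne_top hfin le_self_add
  have hle2 := (ENNReal.add_le_add_iff_right hcfin).1 hle
  by_contra hne
  have e1 : ∫⁻ z in S, ENNReal.ofReal (f z.2) ∂P = ∫⁻ z in S, ENNReal.ofReal (f z.1) ∂P :=
    hint (fun z => ENNReal.ofReal (f z.1)) g1.ennreal_ofReal
  have e2 : ∫⁻ z in S, ENNReal.ofReal (f (z.2.1, z.1.2)) ∂P
      = ∫⁻ z in S, ENNReal.ofReal (f (z.1.1, z.2.2)) ∂P :=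
    hint (fun z => ENNReal.ofReal (f (z.1.1, z.2.2))) g12.ennreal_ofReal
  have s1 : ∫⁻ z in S, ENNReal.ofReal (f z.1 + f z.2) ∂P
      = ∫⁻ z in S, ENNReal.ofReal (f z.1) ∂P + ∫⁻ z in S, ENNReal.ofReal (f z.1) ∂P := by
    nth_rw 2 [← e1]
    rw [← lintegral_add_left g1.ennreal_ofReal]
    exact lintegral_congr fun z => ENNReal.ofReal_add (hf0 _) (hf0 _)
  have s2 : ∫⁻ z in S, ENNReal.ofReal (f (z.1.1, z.2.2) + f (z.2.1, z.1.2)) ∂P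
      = ∫⁻ z in S, ENNReal.ofReal (f (z.1.1, z.2.2)) ∂P
        + ∫⁻ z in S, ENNReal.ofReal (f (z.1.1, z.2.2)) ∂P := by
    nth_rw 2 [← e2]
    rw [← lintegral_add_left g12.ennreal_ofReal]
    exact lintegral_congr fun z => ENNReal.ofReal_add (hf0 _) (hf0 _)
  have hmono : ∫⁻ z in S, ENNReal.ofReal (f (z.1.1, z.2.2) + f (z.2.1, z.1.2)) ∂P
      ≤ ∫⁻ z in S, ENNReal.ofReal (f z.1 + f z.2) ∂P :=
    setLIntegral_mono (g1.add g2).ennreal_ofReal fun z hz => ENNReal.ofReal_le_ofReal (le_of_lt hz)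
  have hlt : ∫⁻ z in S, ENNReal.ofReal (f (z.1.1, z.2.2) + f (z.2.1, z.1.2)) ∂P
      < ∫⁻ z in S, ENNReal.ofReal (f z.1 + f z.2) ∂P := by
    refine setLIntegral_strict_mono mS hne (g1.add g2).ennreal_ofReal
      (ne_top_of_le_ne_top (by rw [s1]; finiteness) hmono) (Eventually.of_forall fun z hz => ?_)
    have hz' : f (z.1.1, z.2.2) + f (z.2.1, z.1.2) < f z.1 + f z.2 := hz
    exact (ENNReal.ofReal_lt_ofReal_iff (lt_of_le_of_lt (add_nonneg (hf0 _) (hf0 _)) hz')).2 hz'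
  rw [s1, s2] at hlt
  exact absurd (add_le_add hle2 hle2) (not_le.2 hlt)

lemma support_mono_pair {X : Type*} [MeasurableSpace X] [TopologicalSpace X] 
    {f : X × X → ℝ} (hf : Continuous f) (γ : Measure (X × X)) [SFinite γ]
    (h0 : (γ.prod γ) {z | f (z.1.1, z.2.2) + f (z.2.1, z.1.2) < f z.1 + f z.2} = 0)
    {p q : X × X} (hp : p ∈ γ.support) (hq : q ∈ γ.support) :
    f p + f q ≤ f (p.1, q.2) + f (q.1, p.2) := by
  by_contra! hlt
  have hopen : IsOpen {z : (X × X) × (X × X) | f (z.1.1, z.2.2) + f (z.2.1, z.1.2) < f z.1 + f z.2} :=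
    isOpen_lt (by fun_prop) (by fun_prop)
  have hmem : {z : (X × X) × (X × X) | f (z.1.1, z.2.2) + f (z.2.1, z.1.2) < f z.1 + f z.2}
      ∈ nhds (p, q) := hopen.mem_nhds hlt
  rw [nhds_prod_eq, Filter.mem_prod_iff] at hmem
  obtain ⟨U, hU, V, hV, hUV⟩ := hmem
  rw [Measure.mem_support_iff_forall] at hp hq
  have := measure_mono_null hUV h0
  rw [Measure.prod_prod] at this
  exact absurd this (mul_pos (hp U hU).ne' (hq V hV).ne').ne'

/-- local contradiction from strict convexity -/
lemma convex_local {E : Type*} [NormedAddCommGroup E] [NormedSpace ℝ E] {h : E → ℝ}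
    (hc : Continuous h) (hconv : StrictConvexOn ℝ Set.univ h) {x y₀ y₁ : E} (hne : y₀ ≠ y₁) :
    ∃ ε > 0, ∀ y' v' : E, dist y' y₀ < ε → dist v' (y₁ - y₀) < ε → ∀ t : ℝ, 0 < t → t ≤ 1 / 2 →
      h (x + t • v' - y₁) + h (x - y') < h (x + t • v' - y') + h (x - y₁) := by
  have hcont : Continuous (fun p : E × E => h (x - p.1) - h (x - p.1 - (1/2 : ℝ) • p.2)
      - (h (x - y₁ + (1/2 : ℝ) • p.2) - h (x - y₁))) := by fun_prop
  have hpos : 0 < (fun p : E × E => h (x - p.1) - h (x - p.1 - (1/2 : ℝ) • p.2)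
      - (h (x - y₁ + (1/2 : ℝ) • p.2) - h (x - y₁))) (y₀, y₁ - y₀) := by
    have := hconv.2 (Set.mem_univ (x - y₀)) (Set.mem_univ (x - y₁)) (by simpa using hne)
      (show (0:ℝ) < 1/2 by norm_num) (show (0:ℝ) < 1/2 by norm_num) (by norm_num)
    simp only [smul_eq_mul] at this
    have e1 : x - y₀ - (1/2 : ℝ) • (y₁ - y₀) = (1/2 : ℝ) • (x - y₀) + (1/2 : ℝ) • (x - y₁) := by
      module
    have e2 : x - y₁ + (1/2 : ℝ) • (y₁ - y₀) = (1/2 : ℝ) • (x - y₀) + (1/2 : ℝ) • (x - y₁) := by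
      module
    simp only [e1, e2]
    linarith
  obtain ⟨ε, hε, hball⟩ := Metric.mem_nhds_iff.1 ((isOpen_lt continuous_const hcont).mem_nhds hpos)
  refine ⟨ε, hε, fun y' v' hy hv t ht ht2 => ?_⟩
  have hin : (y', v') ∈ Metric.ball (y₀, y₁ - y₀) ε := by
    rw [Metric.mem_ball, Prod.dist_eq]; exact max_lt hy hv
  have hk : 0 < h (x - y') - h (x - y' - (1/2 : ℝ) • v')
      - (h (x - y₁ + (1/2 : ℝ) • v') - h (x - y₁)) := hball hin
  -- slope inequalities
  have hb := hconv.convexOn.2 (Set.mem_univ (x - y₁)) (Set.mem_univ (x - y₁ + (1/2 : ℝ) • v'))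
    (show 0 ≤ 1 - 2 * t by linarith) (show 0 ≤ 2 * t by linarith) (by ring)
  have eb : (1 - 2 * t) • (x - y₁) + (2 * t) • (x - y₁ + (1/2 : ℝ) • v') = x + t • v' - y₁ := by
    module
  rw [eb, smul_eq_mul, smul_eq_mul] at hb
  have h12 : 0 < 1 + 2 * t := by linarith
  have ha := hconv.convexOn.2 (Set.mem_univ (x + t • v' - y')) (Set.mem_univ (x - y' - (1/2 : ℝ) • v'))
    (show 0 ≤ 1 / (1 + 2 * t) by positivity) (show 0 ≤ 2 * t / (1 + 2 * t) by positivity) (by field_simp)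
  have ea : (1 / (1 + 2 * t)) • (x + t • v' - y') + (2 * t / (1 + 2 * t)) • (x - y' - (1/2 : ℝ) • v')
      = x - y' := by
    have e3 : (1 / (1 + 2 * t)) • (x + t • v' - y') + (2 * t / (1 + 2 * t)) • (x - y' - (1/2 : ℝ) • v')
      = (1 / (1 + 2 * t) + 2 * t / (1 + 2 * t)) • (x - y') := by module
    rw [e3, show 1 / (1 + 2 * t) + 2 * t / (1 + 2 * t) = 1 by field_simp, one_smul]
  rw [ea, smul_eq_mul, smul_eq_mul] at ha
  have ha2 : (1 + 2 * t) * h (x - y') ≤ h (x + t • v' - y') + 2 * t * h (x - y' - (1/2 : ℝ) • v') := by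
    have := mul_le_mul_of_nonneg_left ha h12.le
    have e4 : (1 + 2 * t) * (1 / (1 + 2 * t) * h (x + t • v' - y') +
      2 * t / (1 + 2 * t) * h (x - y' - (1/2 : ℝ) • v'))
      = h (x + t • v' - y') + 2 * t * h (x - y' - (1/2 : ℝ) • v') := by field_simp
    rwa [e4] at this
  have := mul_pos ht hk
  nlinarith

/-- Density points: at almost every point of `A`, `A` meets all thin truncated cones. -/
lemma cone_ae (A : Set (EuclideanSpace ℝ (Fin d))) (hA : MeasurableSet A) :
    ∀ᵐ x ∂(volume : Measure (EuclideanSpace ℝ (Fin d))), x ∈ A →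
      ∀ (v : EuclideanSpace ℝ (Fin d)) (η : ℝ), 0 < η → ∃ t : ℝ, 0 < t ∧ t ≤ 1 / 2 ∧
        ∃ x' ∈ A, dist x' (x + t • v) ≤ η * t := by
  have h := fun k : ℕ => (ae_restrict_iff' hA).1
    (IsUnifLocDoublingMeasure.ae_tendsto_measure_inter_div
      (volume : Measure (EuclideanSpace ℝ (Fin d))) A (k : ℝ))
  filter_upwards [ae_all_iff.2 h] with x hx hxA v η hη
  obtain ⟨k, hk⟩ := exists_nat_ge (‖v‖ / η)
  have hlim := hx k hxA (l := nhdsWithin (0 : ℝ) (Set.Ioi 0)) (fun t : ℝ => x + t • v) (fun t => η * t)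
    (by
      rw [tendsto_nhdsWithin_iff]
      constructor
      · have : Tendsto (fun t : ℝ => η * t) (nhds 0) (nhds (η * 0)) := tendsto_id.const_mul η
        rw [mul_zero] at this
        exact this.mono_left nhdsWithin_le_nhds
      · filter_upwards [self_mem_nhdsWithin] with t ht
        exact mul_pos hη ht)
    (by
      filter_upwards [self_mem_nhdsWithin] with t ht
      have ht : 0 < t := ht
      rw [Metric.mem_closedBall, dist_self_add_right, norm_smul, Real.norm_of_nonneg ht.le]
      rw [div_le_iff₀ hη] at hk
      nlinarith)
  have hev := hlim.eventually (lt_mem_nhds (zero_lt_one : (0 : ℝ≥0∞) < 1))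
  have hhalf : ∀ᶠ t in nhdsWithin (0 : ℝ) (Set.Ioi 0), t ≤ 1 / 2 :=
    nhdsWithin_le_nhds (Iic_mem_nhds (by norm_num))
  obtain ⟨t, ht1, ht2, ht3⟩ := (hev.and (hhalf.and self_mem_nhdsWithin)).exists
  refine ⟨t, ht3, ht2, ?_⟩
  have : (A ∩ Metric.closedBall (x + t • v) (η * t)).Nonempty := by
    rw [Set.nonempty_iff_ne_empty]
    intro he
    rw [he] at ht1
    simp at ht1
  obtain ⟨x', hx', hx''⟩ := this
  exact ⟨x', hx', hx''⟩

lemma measurable_proj (Γ : Set (EuclideanSpace ℝ (Fin d) × EuclideanSpace ℝ (Fin d)))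
    (hΓ : IsClosed Γ) : MeasurableSet (Prod.fst '' Γ) := by
  have : IsSigmaCompact (Prod.fst '' Γ) := (isSigmaCompact_univ.of_isClosed_subset hΓ
    (Set.subset_univ _)).image continuous_fst
  obtain ⟨K, hK, hU⟩ := this
  rw [← hU]
  exact MeasurableSet.iUnion fun n => (hK n).measurableSet

lemma graph_ae {h : EuclideanSpace ℝ (Fin d) → ℝ} (hc : Continuous h)
    (hconv : StrictConvexOn ℝ Set.univ h)
    (Γ : Set (EuclideanSpace ℝ (Fin d) × EuclideanSpace ℝ (Fin d))) (hΓ : IsClosed Γ)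
    (hmon : ∀ p ∈ Γ, ∀ q ∈ Γ, h (p.1 - p.2) + h (q.1 - q.2) ≤ h (p.1 - q.2) + h (q.1 - p.2)) :
    ∀ᵐ x ∂(volume : Measure (EuclideanSpace ℝ (Fin d))),
      ∀ y₀ y₁, (x, y₀) ∈ Γ → (x, y₁) ∈ Γ → y₀ = y₁ := by
  have h1 := fun (n k : ℕ) => cone_ae _ (measurable_proj (Γ ∩ Prod.snd ⁻¹'
    (Metric.closedBall (TopologicalSpace.denseSeq (EuclideanSpace ℝ (Fin d)) n) (1 / (k + 1))))
    (hΓ.inter (Metric.isClosed_closedBall.preimage continuous_snd)))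
  filter_upwards [ae_all_iff.2 fun n => ae_all_iff.2 (h1 n)] with x hx y₀ y₁ h₀ h₁
  by_contra hne
  obtain ⟨ε, hε, hloc⟩ := convex_local (x := x) hc hconv hne
  obtain ⟨k, hk⟩ := exists_nat_one_div_lt (half_pos hε)
  obtain ⟨n, hn⟩ := (TopologicalSpace.denseRange_denseSeq
    (EuclideanSpace ℝ (Fin d))).exists_dist_lt y₀ (by positivity : (0 : ℝ) < 1 / ((k : ℝ) + 1))
  obtain ⟨t, ht0, ht1, x', ⟨⟨x'', y'⟩, ⟨hxy, hy'⟩, rfl⟩, hdist⟩ := hx n k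
    ⟨(x, y₀), ⟨h₀, by simpa using hn.le⟩, rfl⟩ (y₁ - y₀) (ε / 2) (half_pos hε)
  simp only [Set.mem_preimage, Metric.mem_closedBall] at hy' hdist
  have hyy : dist y' y₀ < ε := by
    have := dist_triangle_right y' y₀ (TopologicalSpace.denseSeq (EuclideanSpace ℝ (Fin d)) n)
    linarith
  have hv : dist (t⁻¹ • (x'' - x)) (y₁ - y₀) < ε := by
    have e : x'' - (x + t • (y₁ - y₀)) = t • (t⁻¹ • (x'' - x) - (y₁ - y₀)) := by
      rw [smul_sub t (t⁻¹ • (x'' - x)), smul_inv_smul₀ ht0.ne']; abel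
    rw [dist_eq_norm, e, norm_smul, Real.norm_of_nonneg ht0.le, mul_comm] at hdist
    rw [dist_eq_norm]
    have := le_of_mul_le_mul_right hdist ht0
    linarith
  have hfin := hloc y' _ hyy hv t ht0 ht1
  rw [smul_inv_smul₀ ht0.ne', add_sub_cancel] at hfin
  have := hmon _ hxy _ h₁
  simp only at this
  linarith

lemma plan_eq {γ γ₁ γ₂ : Measure (EuclideanSpace ℝ (Fin d) × EuclideanSpace ℝ (Fin d))}
    [IsProbabilityMeasure γ₁] [IsProbabilityMeasure γ₂]
    (h₁ : γ₁ ≪ γ) (h₂ : γ₂ ≪ γ) (hm : γ₁.map Prod.fst = γ₂.map Prod.fst)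
    (hac : γ₁.map Prod.fst ≪ volume)
    (hg : ∀ᵐ x ∂(volume : Measure (EuclideanSpace ℝ (Fin d))),
      ∀ y₀ y₁, (x, y₀) ∈ γ.support → (x, y₁) ∈ γ.support → y₀ = y₁) : γ₁ = γ₂ := by
  have key : ∀ γ' : Measure (EuclideanSpace ℝ (Fin d) × EuclideanSpace ℝ (Fin d)), γ' ≪ γ →
      γ'.map Prod.fst ≪ volume → ∀ (A B : Set (EuclideanSpace ℝ (Fin d))), MeasurableSet A → IsClosed B →
      γ' (A ×ˢ B) = γ'.map Prod.fst (A ∩ Prod.fst '' (γ.support ∩ Prod.snd ⁻¹' B)) := by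
    intro γ' hγ' hac' A B hA hB
    have mB := measurable_proj (γ.support ∩ Prod.snd ⁻¹' B)
      (Measure.isClosed_support.inter (hB.preimage continuous_snd))
    rw [Measure.map_apply measurable_fst (hA.inter mB)]
    refine measure_congr ?_
    have hs : ∀ᵐ p ∂γ', p ∈ γ.support := hγ'.ae_le Measure.support_mem_ae
    have hg' := ae_of_ae_map measurable_fst.aemeasurable (hac'.ae_le hg)
    filter_upwards [hs, hg'] with p hp hp2
    refine propext ⟨fun hh => ?_, fun hh => ?_⟩
    · exact ⟨hh.1, p, ⟨hp, hh.2⟩, rfl⟩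
    · obtain ⟨hA', ⟨x, y⟩, ⟨hq, hq2⟩, hq3⟩ := hh
      simp only at hq3
      subst hq3
      refine ⟨hA', ?_⟩
      rw [hp2 p.2 y hp hq]
      exact hq2
  refine ext_of_generate_finite
    (Set.image2 (· ×ˢ ·) {A : Set (EuclideanSpace ℝ (Fin d)) | MeasurableSet A}
      {B : Set (EuclideanSpace ℝ (Fin d)) | IsClosed B}) ?_ ?_ ?_ (by simp)
  · refine (generateFrom_eq_prod MeasurableSpace.generateFrom_measurableSet
      (borel_eq_generateFrom_isClosed.symm.trans (BorelSpace.measurable_eq).symm) ?_ ?_).symm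
    · exact ⟨fun _ => Set.univ, fun _ => (MeasurableSet.univ : MeasurableSet (Set.univ : Set (EuclideanSpace ℝ (Fin d)))), Set.iUnion_const _⟩
    · exact ⟨fun _ => Set.univ, fun _ => isClosed_univ, Set.iUnion_const _⟩
  · exact MeasurableSpace.isPiSystem_measurableSet.prod isPiSystem_isClosed
  · rintro _ ⟨A, hA, B, hB, rfl⟩
    rw [key γ₁ h₁ hac A B hA hB, key γ₂ h₂ (hm ▸ hac) A B hA hB, hm]
end OT

section Final
variable {d : ℕ} {Λ : ℝ} {μ ν : Measure (EuclideanSpace ℝ (Fin d))}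

lemma div_restrict {α : Type*} [MeasurableSpace α] (μ : Measure α) [IsProbabilityMeasure μ]
    {B : Set α} (hB : MeasurableSet B) (h0 : μ B ≠ 0) :
    divergenceF Fkl ((μ B)⁻¹ • μ.restrict B) μ ≠ ⊤ := by
  have hc : (μ B)⁻¹ ≠ ⊤ := ENNReal.inv_ne_top.2 h0
  have hac : (μ B)⁻¹ • μ.restrict B ≪ μ :=
    Measure.AbsolutelyContinuous.smul_left Measure.absolutelyContinuous_restrict _
  rw [divergenceF, if_pos hac]
  have hF : ∀ r : ℝ≥0∞, r ≠ ⊤ → Fkl r ≠ ⊤ := fun r hr => by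
    rw [Fkl_eq hr]; exact ENNReal.ofReal_ne_top
  refine ne_top_of_le_ne_top (b := Fkl 0 + Fkl (μ B)⁻¹)
    (ENNReal.add_ne_top.2 ⟨hF _ ENNReal.zero_ne_top, hF _ hc⟩) ?_
  calc ∫⁻ x, Fkl (((μ B)⁻¹ • μ.restrict B).rnDeriv μ x) ∂μ
      ≤ ∫⁻ x, (Fkl 0 + Fkl (μ B)⁻¹) ∂μ := by
        refine lintegral_mono_ae ?_
        filter_upwards [Measure.rnDeriv_smul_left_of_ne_top (μ.restrict B) μ hc,
          Measure.rnDeriv_restrict_self μ hB] with x h1 h2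
        rw [h1, Pi.smul_apply, h2]
        by_cases hx : x ∈ B
        · simp [hx]
        · simp [hx]
    _ = _ := by simp

lemma exists_competitor [IsProbabilityMeasure μ] [IsProbabilityMeasure ν]
    {f : EuclideanSpace ℝ (Fin d) × EuclideanSpace ℝ (Fin d) → ℝ} (hf : Continuous f) :
    ∃ γ, IsProbabilityMeasure γ ∧ ETKL (fun p => ENNReal.ofReal (f p)) Λ μ ν γ ≠ ⊤ := by
  have hball : ∀ σ : Measure (EuclideanSpace ℝ (Fin d)), IsProbabilityMeasure σ →
      ∃ n : ℕ, σ (Metric.closedBall 0 n) ≠ 0 := by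
    intro σ _
    by_contra! hcon
    have := measure_iUnion_null hcon
    rw [Metric.iUnion_closedBall_nat] at this
    simp at this
  obtain ⟨n, hn⟩ := hball μ inferInstance
  obtain ⟨k, hk⟩ := hball ν inferInstance
  set A : Set (EuclideanSpace ℝ (Fin d)) := Metric.closedBall 0 n
  set B : Set (EuclideanSpace ℝ (Fin d)) := Metric.closedBall 0 k
  have mA : MeasurableSet A := Metric.isClosed_closedBall.measurableSet
  have mB : MeasurableSet B := Metric.isClosed_closedBall.measurableSet
  set σ := (μ A)⁻¹ • μ.restrict A with hσ
  set τ := (ν B)⁻¹ • ν.restrict B with hτ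
  have pσ : IsProbabilityMeasure σ := ⟨by
    simp [hσ, ENNReal.inv_mul_cancel hn (measure_ne_top μ A)]⟩
  have pτ : IsProbabilityMeasure τ := ⟨by
    simp [hτ, ENNReal.inv_mul_cancel hk (measure_ne_top ν B)]⟩
  refine ⟨σ.prod τ, inferInstance, ?_⟩
  have e1 : (σ.prod τ).map Prod.fst = σ := Measure.fst_prod
  have e2 : (σ.prod τ).map Prod.snd = τ := Measure.snd_prod
  have hcost : ∫⁻ p, ENNReal.ofReal (f p) ∂(σ.prod τ) ≠ ⊤ := by
    obtain ⟨C, hC⟩ := ((isCompact_closedBall (0 : EuclideanSpace ℝ (Fin d)) n).prod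
      (isCompact_closedBall (0 : EuclideanSpace ℝ (Fin d)) k)).bddAbove_image hf.continuousOn
    have hae : ∀ᵐ p ∂(σ.prod τ), p ∈ A ×ˢ B := by
      refine (mem_ae_iff_prob_eq_one (mA.prod mB)).2 ?_
      rw [Measure.prod_prod]
      simp [hσ, hτ, ENNReal.inv_mul_cancel hn (measure_ne_top μ A),
        ENNReal.inv_mul_cancel hk (measure_ne_top ν B)]
    refine ne_top_of_le_ne_top (b := ENNReal.ofReal C) ENNReal.ofReal_ne_top ?_
    calc ∫⁻ p, ENNReal.ofReal (f p) ∂(σ.prod τ) ≤ ∫⁻ p, ENNReal.ofReal C ∂(σ.prod τ) := by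
          refine lintegral_mono_ae ?_
          filter_upwards [hae] with p hp
          exact ENNReal.ofReal_le_ofReal (hC ⟨p, hp, rfl⟩)
      _ = _ := by simp
  rw [ETKL, e1, e2]
  exact ENNReal.add_ne_top.2 ⟨ENNReal.add_ne_top.2 ⟨hcost,
    ENNReal.mul_ne_top ENNReal.ofReal_ne_top (div_restrict μ mA hn)⟩,
    ENNReal.mul_ne_top ENNReal.ofReal_ne_top (div_restrict ν mB hk)⟩

lemma eq_of_l1d {α : Type*} [MeasurableSpace α] {μ σ₁ σ₂ : Measure α} [IsFiniteMeasure μ]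
    [IsFiniteMeasure σ₁] [IsFiniteMeasure σ₂] (h₁ : σ₁ ≪ μ) (h₂ : σ₂ ≪ μ)
    (h : l1d μ σ₁ σ₂ = 0) : σ₁ = σ₂ := by
  rw [l1d, lintegral_eq_zero_iff (by fun_prop)] at h
  rw [← Measure.withDensity_rnDeriv_eq _ _ h₁, ← Measure.withDensity_rnDeriv_eq _ _ h₂]
  refine withDensity_congr_ae ?_
  filter_upwards [h, Measure.rnDeriv_lt_top σ₁ μ, Measure.rnDeriv_lt_top σ₂ μ] with x hx t1 t2
  have : |(σ₁.rnDeriv μ x).toReal - (σ₂.rnDeriv μ x).toReal| ≤ 0 := by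
    simpa [ENNReal.ofReal_eq_zero] using hx
  have h3 := abs_nonpos_iff.1 this
  exact (ENNReal.toReal_eq_toReal_iff' t1.ne t2.ne).1 (sub_eq_zero.1 h3)

lemma unique_min [IsProbabilityMeasure μ] [IsProbabilityMeasure ν] (hΛ : 0 < Λ)
    (hμ : μ ≪ (volume : Measure (EuclideanSpace ℝ (Fin d))))
    {h : EuclideanSpace ℝ (Fin d) → ℝ} (hc : Continuous h) (hh0 : ∀ x, 0 ≤ h x)
    (hhconv : StrictConvexOn ℝ Set.univ h)
    {γ₁ γ₂ : Measure (EuclideanSpace ℝ (Fin d) × EuclideanSpace ℝ (Fin d))}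
    (p₁ : IsProbabilityMeasure γ₁) (p₂ : IsProbabilityMeasure γ₂)
    (m₁ : ∀ γ', IsProbabilityMeasure γ' →
      ETKL (fun p => ENNReal.ofReal (h (p.1 - p.2))) Λ μ ν γ₁
        ≤ ETKL (fun p => ENNReal.ofReal (h (p.1 - p.2))) Λ μ ν γ')
    (m₂ : ∀ γ', IsProbabilityMeasure γ' →
      ETKL (fun p => ENNReal.ofReal (h (p.1 - p.2))) Λ μ ν γ₂
        ≤ ETKL (fun p => ENNReal.ofReal (h (p.1 - p.2))) Λ μ ν γ') : γ₁ = γ₂ := by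
  have hf : Continuous (fun p : EuclideanSpace ℝ (Fin d) × EuclideanSpace ℝ (Fin d) =>
    h (p.1 - p.2)) := by fun_prop
  set c : EuclideanSpace ℝ (Fin d) × EuclideanSpace ℝ (Fin d) → ℝ≥0∞ :=
    fun p => ENNReal.ofReal (h (p.1 - p.2)) with hcdef
  obtain ⟨γc, pc, hγc⟩ := exists_competitor (Λ := Λ) (μ := μ) (ν := ν) hf
  have heq : ETKL c Λ μ ν γ₁ = ETKL c Λ μ ν γ₂ := le_antisymm (m₁ _ p₂) (m₂ _ p₁)
  have hfin1 : ETKL c Λ μ ν γ₁ ≠ ⊤ := ne_top_of_le_ne_top hγc (m₁ _ pc)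
  have hfin2 : ETKL c Λ μ ν γ₂ ≠ ⊤ := heq ▸ hfin1
  obtain ⟨c1, d1, d1'⟩ := ETKL_parts hΛ hfin1
  obtain ⟨c2, d2, d2'⟩ := ETKL_parts hΛ hfin2
  have hl : l1d μ (γ₁.map Prod.fst) (γ₂.map Prod.fst)
      + l1d ν (γ₁.map Prod.snd) (γ₂.map Prod.snd) = 0 := by
    refine le_antisymm (ENNReal.le_of_forall_pos_le_add fun ε hε _ => ?_) bot_le
    have hε' : (0 : ℝ) < (ε : ℝ) / 16 := by positivity
    have := key_gap (c := c) (Λ := Λ) (μ := μ) (ν := ν) (γ₁ := γ₁) (γ₂ := γ₂) hΛ hfin1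
      (le_refl 0) hε' m₁ (by simp) (by simp [heq])
    refine this.trans ?_
    rw [zero_div, add_zero, mul_div_cancel₀ _ (by norm_num), zero_add, ENNReal.ofReal_coe_nnreal]
  obtain ⟨hl1, hl2⟩ := add_eq_zero.1 hl
  have i1 : IsProbabilityMeasure (γ₁.map Prod.fst) :=
    Measure.isProbabilityMeasure_map measurable_fst.aemeasurable
  have i2 : IsProbabilityMeasure (γ₂.map Prod.fst) :=
    Measure.isProbabilityMeasure_map measurable_fst.aemeasurable
  have i3 : IsProbabilityMeasure (γ₁.map Prod.snd) :=
    Measure.isProbabilityMeasure_map measurable_snd.aemeasurable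
  have i4 : IsProbabilityMeasure (γ₂.map Prod.snd) :=
    Measure.isProbabilityMeasure_map measurable_snd.aemeasurable
  have E1 : γ₁.map Prod.fst = γ₂.map Prod.fst := eq_of_l1d (ac_of_div d1) (ac_of_div d2) hl1
  have E2 : γ₁.map Prod.snd = γ₂.map Prod.snd := eq_of_l1d (ac_of_div d1') (ac_of_div d2') hl2
  have half : ∀ {α : Type} [MeasurableSpace α] (σ : Measure α),
      (2⁻¹ : ℝ≥0∞) • (σ + σ) = σ := by
    intro α _ σ
    rw [smul_add, ← add_smul, ENNReal.inv_two_add_inv_two, one_smul]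
  set γ := (2⁻¹ : ℝ≥0∞) • (γ₁ + γ₂) with hγ
  have pγ : IsProbabilityMeasure γ := ⟨by
    rw [hγ, Measure.smul_apply, Measure.add_apply, measure_univ, measure_univ, smul_eq_mul,
      mul_add, mul_one, ENNReal.inv_two_add_inv_two]⟩
  have M1 : γ.map Prod.fst = γ₁.map Prod.fst := by
    rw [hγ, Measure.map_smul, Measure.map_add _ _ measurable_fst, ← E1, half]
  have M2 : γ.map Prod.snd = γ₁.map Prod.snd := by
    rw [hγ, Measure.map_smul, Measure.map_add _ _ measurable_snd, ← E2, half]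
  have D1 : ENNReal.ofReal Λ * divergenceF Fkl (γ₁.map Prod.fst) μ ≠ ⊤ :=
    ENNReal.mul_ne_top ENNReal.ofReal_ne_top d1
  have D2 : ENNReal.ofReal Λ * divergenceF Fkl (γ₁.map Prod.snd) ν ≠ ⊤ :=
    ENNReal.mul_ne_top ENNReal.ofReal_ne_top d1'
  have C12 : ∫⁻ p, c p ∂γ₂ = ∫⁻ p, c p ∂γ₁ := by
    have := heq
    rw [ETKL, ETKL, ← E1, ← E2] at this
    exact ((ENNReal.add_left_inj D1).1 ((ENNReal.add_left_inj D2).1 this)).symm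
  have Cγ : ∫⁻ p, c p ∂γ = ∫⁻ p, c p ∂γ₁ := by
    rw [hγ, lintegral_smul_measure, lintegral_add_measure, C12, smul_eq_mul, mul_add, ← add_mul,
      ENNReal.inv_two_add_inv_two, one_mul]
  have hopt : ∀ γ' : Measure (EuclideanSpace ℝ (Fin d) × EuclideanSpace ℝ (Fin d)),
      IsProbabilityMeasure γ' → γ'.map Prod.fst = γ.map Prod.fst →
      γ'.map Prod.snd = γ.map Prod.snd →
      ∫⁻ p, ENNReal.ofReal (h (p.1 - p.2)) ∂γ ≤ ∫⁻ p, ENNReal.ofReal (h (p.1 - p.2)) ∂γ' := by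
    intro γ' p' q1 q2
    have := m₁ γ' p'
    rw [ETKL, ETKL, q1, q2, M1, M2] at this
    have h3 := (ENNReal.add_le_add_iff_right D1).1 ((ENNReal.add_le_add_iff_right D2).1 this)
    rw [← Cγ] at h3
    exact h3
  have hnull := swap_null hf.measurable (fun p => hh0 _) γ (by
    have : ∫⁻ p, c p ∂γ ≠ ⊤ := by rw [Cγ]; exact c1
    exact this) hopt
  have hgraph := graph_ae hc hhconv γ.support Measure.isClosed_support
    (fun p hp q hq => support_mono_pair hf γ hnull hp hq)
  have hsm : γ₁ + γ₂ ≪ γ := Measure.absolutelyContinuous_smul (by simp)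
  have a1 : γ₁ ≪ γ := (Measure.AbsolutelyContinuous.rfl.add_right γ₂).trans hsm
  have a2 : γ₂ ≪ γ := by
    refine Measure.AbsolutelyContinuous.trans ?_ hsm
    rw [add_comm]
    exact Measure.AbsolutelyContinuous.rfl.add_right γ₁
  exact plan_eq a1 a2 E1 ((ac_of_div d1).trans hμ) hgraph
end Final

/-- the constrained entropy transport problem
`inf { E_{Λ,KL}(γ|μ,ν) : γ ∈ P(ℝ^d × ℝ^d) }` admits a unique optimal solution. -/
theorem constrainedET_existsUnique_minimizer {d : ℕ}
    (h : EuclideanSpace ℝ (Fin d) → ℝ) (hh0 : ∀ x, 0 ≤ h x)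
    (hhconv : StrictConvexOn ℝ Set.univ h)
    (c : EuclideanSpace ℝ (Fin d) × EuclideanSpace ℝ (Fin d) → ℝ≥0∞)
    (hch : c = fun p => ENNReal.ofReal (h (p.1 - p.2)))
    (Λ : ℝ) (hΛ : 0 < Λ)
    (μ ν : Measure (EuclideanSpace ℝ (Fin d)))
    [IsProbabilityMeasure μ] [IsProbabilityMeasure ν]
    (hμ : μ ≪ (volume : Measure (EuclideanSpace ℝ (Fin d))))
    (hν : ν ≪ (volume : Measure (EuclideanSpace ℝ (Fin d))))
    (hfin : ∃ γ₀ : Measure (EuclideanSpace ℝ (Fin d) × EuclideanSpace ℝ (Fin d)),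
      IsFiniteMeasure γ₀ ∧ ETKL c Λ μ ν γ₀ < ⊤) :
    ∃! γ : Measure (EuclideanSpace ℝ (Fin d) × EuclideanSpace ℝ (Fin d)),
      IsProbabilityMeasure γ ∧
      ∀ γ' : Measure (EuclideanSpace ℝ (Fin d) × EuclideanSpace ℝ (Fin d)),
        IsProbabilityMeasure γ' → ETKL c Λ μ ν γ ≤ ETKL c Λ μ ν γ' := by
  subst hch
  have hc : Continuous h :=
    continuousOn_univ.1 (hhconv.convexOn.continuousOn isOpen_univ)
  have hf : Continuous (fun p : EuclideanSpace ℝ (Fin d) × EuclideanSpace ℝ (Fin d) =>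
    h (p.1 - p.2)) := by fun_prop
  obtain ⟨γ, pγ, mγ⟩ := exists_min (μ := μ) (ν := ν) hΛ _ hf (fun p => hh0 _)
    (exists_competitor (Λ := Λ) (μ := μ) (ν := ν) hf)
  refine ⟨γ, ⟨pγ, mγ⟩, ?_⟩
  rintro γ' ⟨pγ', mγ'⟩
  exact unique_min hΛ hμ hc hh0 hhconv pγ' pγ mγ' mγ
end
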